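/- Let ℋ = L²((0,∞), p dp) be the complex Hilbert space of square-integrable functions with respect to the measure with density p ↦ p on (0,∞). Let H₀ be the set of all g ∈ ℋ such that there exists a real tempered distribution u on ℝ with support contained in [0,∞) whose Fourier transform restricted to (0,∞) is given by g. Then H₀ is a standard subspace of ℋ: it is a real-linear subspace, it is closed in ℋ, it satisfies H₀ ∩ i·H₀ = {0}, and H₀ + i·H₀ is dense in ℋ. -/

import Mathlib

open MeasureTheory Set

/-- The measure `p dp` on `(0,∞)`. -/
noncomputable def muW : Measure ℝ :=
  (volume.restrict (Ioi 0)).withDensity fun p => ENNReal.ofReal p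

/-- A tempered distribution `u` is real if `u(conj h) = conj (u h)`. -/
def IsRealTD (u : SchwartzMap ℝ ℂ →L[ℂ] ℂ) : Prop :=
  ∀ h h' : SchwartzMap ℝ ℂ, (∀ x, h' x = (starRingEnd ℂ) (h x)) → u h' = (starRingEnd ℂ) (u h)

/-- A tempered distribution `u` has support contained in `[0,∞)` if it kills every
Schwartz function supported in `(-∞,0)`. -/
def SuppInHalfLine (u : SchwartzMap ℝ ℂ →L[ℂ] ℂ) : Prop :=
  ∀ h : SchwartzMap ℝ ℂ, tsupport h ⊆ Iio 0 → u h = 0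

/-- The standard subspace `H₀ ⊆ L²((0,∞), p dp)`: boundary values on `(0,∞)` of Fourier
transforms of real tempered distributions supported in `[0,∞)`. -/
noncomputable def Hzero : Set (Lp ℂ 2 muW) :=
  {g | ∃ u : SchwartzMap ℝ ℂ →L[ℂ] ℂ, IsRealTD u ∧ SuppInHalfLine u ∧
    ∀ h : SchwartzMap ℝ ℂ, HasCompactSupport h → tsupport h ⊆ Ioi 0 →
      u (SchwartzMap.fourierTransformCLM ℂ h) = ∫ p in Ioi 0, g p * h p}

open scoped SchwartzMap FourierTransform ComplexConjugate

lemma integral_muW {E : Type*} [NormedAddCommGroup E] [NormedSpace ℝ E] (f : ℝ → E) :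
    ∫ p, f p ∂muW = ∫ p in Ioi 0, p • f p := by
  rw [muW, integral_withDensity_eq_integral_toReal_smul (by fun_prop) (by simp)]
  refine setIntegral_congr_fun measurableSet_Ioi fun p hp => ?_
  simp [ENNReal.toReal_ofReal (le_of_lt hp)]

lemma integrable_muW_iff {E : Type*} [NormedAddCommGroup E] [NormedSpace ℝ E] {f : ℝ → E} :
    Integrable f muW ↔ IntegrableOn (fun p => p • f p) (Ioi 0) := by
  rw [muW, integrable_withDensity_iff_integrable_smul' (by fun_prop) (by simp)]
  refine integrableOn_congr_fun (fun p hp => ?_) measurableSet_Ioi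
  simp [ENNReal.toReal_ofReal (le_of_lt hp)]

lemma muW_absolutelyContinuous : muW ≪ volume.restrict (Ioi 0) :=
  withDensity_absolutelyContinuous _ _

lemma absolutelyContinuous_muW : volume.restrict (Ioi (0 : ℝ)) ≪ muW :=
  withDensity_absolutelyContinuous' (by fun_prop)
    (by filter_upwards [ae_restrict_mem measurableSet_Ioi] with p hp; simpa using hp)

instance muW_hasTemperateGrowth : muW.HasTemperateGrowth := by
  refine ⟨3, ?_⟩
  rw [integrable_muW_iff]
  have h := (integrable_one_add_norm (E := ℝ) (μ := volume) (r := 2) (by simp)).integrableOn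
    (s := Ioi 0)
  refine h.mono' (by fun_prop) ?_
  filter_upwards [ae_restrict_mem measurableSet_Ioi] with p hp
  have hp : 0 < p := hp
  have h1 : (0 : ℝ) < 1 + p := by linarith
  rw [norm_smul, Real.norm_of_nonneg hp.le,
    Real.norm_of_nonneg (by positivity)]
  rw [show (-((3 : ℕ) : ℝ)) = -2 + -1 by norm_num, Real.rpow_add h1, Real.rpow_neg_one]
  have : 0 < (1 + p) ^ (-2 : ℝ) := by positivity
  calc p * ((1 + p) ^ (-2 : ℝ) * (1 + p)⁻¹) = (1 + p) ^ (-2 : ℝ) * (p / (1 + p)) := by ring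
    _ ≤ (1 + p) ^ (-2 : ℝ) * 1 := by
      gcongr
      rw [div_le_one h1]; linarith
    _ = _ := mul_one _

/-- The class in `L²((0,∞), p dp)` of a Schwartz function. -/
noncomputable def toH : 𝓢(ℝ, ℂ) →L[ℂ] Lp ℂ 2 muW := SchwartzMap.toLpCLM ℂ ℂ 2 muW

lemma coeFn_toH (φ : 𝓢(ℝ, ℂ)) : toH φ =ᵐ[muW] φ := SchwartzMap.coeFn_toLp φ 2 muW

lemma inner_toH (g : Lp ℂ 2 muW) (φ : 𝓢(ℝ, ℂ)) :
    inner ℂ g (toH φ) = ∫ p in Ioi 0, p * (conj (g p) * φ p) := by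
  rw [L2.inner_def]
  simp_rw [← Complex.real_smul]
  rw [← integral_muW (fun p => conj (g p) * φ p)]
  refine integral_congr_ae ?_
  filter_upwards [coeFn_toH φ] with p hp
  rw [hp, RCLike.inner_apply', starRingEnd_apply]

lemma integrable_inner_toH (g : Lp ℂ 2 muW) (φ : 𝓢(ℝ, ℂ)) :
    IntegrableOn (fun p : ℝ => (p : ℂ) * (conj (g p) * φ p)) (Ioi 0) := by
  have h : Integrable (fun p => conj (g p) * φ p) muW := by
    refine (L2.integrable_inner g (toH φ)).congr ?_
    filter_upwards [coeFn_toH φ] with p hp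
    rw [hp, RCLike.inner_apply', starRingEnd_apply]
  simpa using integrable_muW_iff.1 h

lemma coeFn_star_restrict (g : Lp ℂ 2 muW) :
    ∀ᵐ p ∂volume.restrict (Ioi (0 : ℝ)), (star g : Lp ℂ 2 muW) p = conj (g p) :=
  absolutelyContinuous_muW.ae_le (Lp.coeFn_star g)

lemma inner_star_toH (g : Lp ℂ 2 muW) (φ : 𝓢(ℝ, ℂ)) :
    inner ℂ (star g) (toH φ) = ∫ p in Ioi 0, p * (g p * φ p) := by
  rw [inner_toH]
  refine integral_congr_ae ?_
  filter_upwards [coeFn_star_restrict g] with p hp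
  rw [hp, Complex.conj_conj]

lemma tsupport_subset_Iio_iff {f : ℝ → ℂ} :
    tsupport f ⊆ Iio 0 ↔ ∃ a < 0, ∀ x, a ≤ x → f x = 0 := by
  constructor
  · intro h
    have h0 : (0 : ℝ) ∉ tsupport f := fun h' => lt_irrefl (0 : ℝ) (h h')
    have hev := notMem_tsupport_iff_eventuallyEq.1 h0
    obtain ⟨e, he, hball⟩ := Metric.eventually_nhds_iff.1 hev
    refine ⟨-(e / 2), by linarith, fun x hx => ?_⟩
    rcases le_or_gt 0 x with hx0 | hx0
    · exact image_eq_zero_of_notMem_tsupport fun h' => not_lt.2 hx0 (h h')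
    · refine hball ?_
      rw [Real.dist_eq, sub_zero, abs_of_neg hx0]
      linarith
  · rintro ⟨a, ha, hf⟩
    have : Function.support f ⊆ Iic a := fun x hx => by
      by_contra h
      exact hx (hf x (le_of_lt (not_le.1 h)))
    exact (closure_minimal this isClosed_Iic).trans fun x hx => lt_of_le_of_lt hx ha

/-- The primitive of `f` vanishing at `-∞`. -/
noncomputable def primitiveIic (f : ℝ → ℂ) (x : ℝ) : ℂ := ∫ t in Iic x, f t

lemma hasDerivAt_primitiveIic (f : 𝓢(ℝ, ℂ)) (x : ℝ) :
    HasDerivAt (primitiveIic f) (f x) x := by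
  have h : primitiveIic f = fun x => primitiveIic f 0 + ∫ t in (0 : ℝ)..x, f t := by
    funext y
    have := intervalIntegral.integral_Iic_sub_Iic (f := f) (μ := volume) (a := 0) (b := y)
      f.integrable.integrableOn f.integrable.integrableOn
    simp only [primitiveIic, ← this]
    ring
  rw [h]
  exact (intervalIntegral.integral_hasDerivAt_right f.integrable.intervalIntegrable
    (f.continuous.stronglyMeasurableAtFilter _ _) f.continuous.continuousAt).const_add _

lemma deriv_primitiveIic (f : 𝓢(ℝ, ℂ)) : deriv (primitiveIic f) = f :=
  funext fun x => (hasDerivAt_primitiveIic f x).deriv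

lemma contDiff_primitiveIic (f : 𝓢(ℝ, ℂ)) : ContDiff ℝ (⊤ : ℕ∞) (primitiveIic f) := by
  rw [contDiff_infty_iff_deriv]
  exact ⟨fun x => (hasDerivAt_primitiveIic f x).differentiableAt, by
    rw [deriv_primitiveIic]; exact f.smooth ⊤⟩

lemma pow_mul_norm_primitiveIic_le (f : 𝓢(ℝ, ℂ)) (hf : ∫ t, f t = 0) (k : ℕ) (x : ℝ) :
    ‖x‖ ^ k * ‖primitiveIic f x‖ ≤ ∫ t, ‖t‖ ^ k * ‖f t‖ := by
  have key : ∀ s : Set ℝ, MeasurableSet s → (∀ t ∈ s, ‖x‖ ≤ ‖t‖) →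
      ‖x‖ ^ k * ‖∫ t in s, f t‖ ≤ ∫ t, ‖t‖ ^ k * ‖f t‖ := by
    intro s hs hst
    have hi : Integrable (fun t => ‖t‖ ^ k * ‖f t‖) := f.integrable_pow_mul volume k
    calc ‖x‖ ^ k * ‖∫ t in s, f t‖ ≤ ‖x‖ ^ k * ∫ t in s, ‖f t‖ := by
          gcongr; exact norm_integral_le_integral_norm _
      _ = ∫ t in s, ‖x‖ ^ k * ‖f t‖ := (integral_const_mul _ _).symm
      _ ≤ ∫ t in s, ‖t‖ ^ k * ‖f t‖ := by
          refine setIntegral_mono_on (f.integrable.norm.const_mul _).integrableOn hi.integrableOn hs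
            fun t ht => ?_
          gcongr
          exact hst t ht
      _ ≤ _ := setIntegral_le_integral hi (Filter.Eventually.of_forall fun t => by positivity)
  rcases le_total x 0 with hx | hx
  · refine key (Iic x) measurableSet_Iic fun t ht => ?_
    have ht : t ≤ x := ht
    rw [Real.norm_of_nonpos hx, Real.norm_of_nonpos (ht.trans hx)]
    linarith
  · have h : primitiveIic f x = -∫ t in Ioi x, f t := by
      have := intervalIntegral.integral_Iic_add_Ioi (f := f) (μ := volume) (b := x)
        f.integrable.integrableOn f.integrable.integrableOn
      rw [hf] at this
      exact eq_neg_of_add_eq_zero_left this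
    rw [h, norm_neg]
    refine key (Ioi x) measurableSet_Ioi fun t ht => ?_
    have ht : x < t := ht
    rw [Real.norm_of_nonneg hx, Real.norm_of_nonneg (hx.trans ht.le)]
    exact ht.le

/-- Subtract a multiple of `ψ` so that the integral becomes zero (when `∫ ψ = 1`). -/
noncomputable def meanFree (ψ : 𝓢(ℝ, ℂ)) : 𝓢(ℝ, ℂ) →L[ℂ] 𝓢(ℝ, ℂ) :=
  ContinuousLinearMap.id ℂ _ - (SchwartzMap.integralCLM ℂ volume).smulRight ψ

lemma meanFree_apply (ψ f : 𝓢(ℝ, ℂ)) : meanFree ψ f = f - (∫ t, f t) • ψ := rfl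

lemma meanFree_eq_self (ψ : 𝓢(ℝ, ℂ)) {f : 𝓢(ℝ, ℂ)} (hf : ∫ t, f t = 0) : meanFree ψ f = f := by
  rw [meanFree_apply, hf, zero_smul, sub_zero]

lemma integral_meanFree {ψ : 𝓢(ℝ, ℂ)} (hψ : ∫ t, ψ t = 1) (f : 𝓢(ℝ, ℂ)) :
    ∫ t, meanFree ψ f t = 0 := by
  have : ∀ t, meanFree ψ f t = f t - (∫ s, f s) * ψ t := fun t => rfl
  simp_rw [this]
  rw [integral_sub f.integrable (ψ.integrable.const_mul _), integral_const_mul, hψ, mul_one,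
    sub_self]

/-- The primitive of the mean-free part of a Schwartz function, as a Schwartz function. -/
noncomputable def primitiveCLM (ψ : 𝓢(ℝ, ℂ)) (hψ : ∫ t, ψ t = 1) : 𝓢(ℝ, ℂ) →L[ℂ] 𝓢(ℝ, ℂ) :=
  SchwartzMap.mkCLM (σ := RingHom.id ℂ) (fun f x => primitiveIic (meanFree ψ f) x)
    (fun f g x => by
      rw [map_add]
      exact integral_add (meanFree ψ f).integrable.integrableOn
        (meanFree ψ g).integrable.integrableOn)
    (fun a f x => by
      rw [map_smul]
      exact integral_const_mul a _)
    (fun f => contDiff_primitiveIic _)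
    (by
      rintro ⟨k, n⟩
      suffices h : ∃ q : Seminorm ℂ 𝓢(ℝ, ℂ), Continuous q ∧ ∀ (r : 𝓢(ℝ, ℂ)), ∫ t, r t = 0 → ∀ x,
          ‖x‖ ^ k * ‖iteratedFDeriv ℝ n (primitiveIic r) x‖ ≤ q r by
        obtain ⟨q, hq, hr⟩ := h
        obtain ⟨s, C, -, hC⟩ := Seminorm.bound_of_continuous (schwartz_withSeminorms ℂ ℝ ℂ)
          (q.comp (meanFree ψ).toLinearMap) (hq.comp (meanFree ψ).continuous)
        exact ⟨s, C, C.2, fun f x => (hr _ (integral_meanFree hψ f) x).trans (hC f)⟩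
      have hcont : ∀ i j, Continuous (SchwartzMap.seminorm ℂ (E := ℝ) (F := ℂ) i j) := fun i j =>
        (schwartz_withSeminorms ℂ ℝ ℂ).continuous_seminorm (i, j)
      rcases n with _ | n
      · let c : ℝ := 2 ^ (volume : Measure ℝ).integrablePower *
          ∫ x : ℝ, (1 + ‖x‖) ^ (-((volume : Measure ℝ).integrablePower : ℝ))
        have hc : 0 ≤ c := by positivity
        lift c to NNReal using hc with c' hc'
        refine ⟨c' • (SchwartzMap.seminorm ℂ (E := ℝ) (F := ℂ) 0 0 +
          SchwartzMap.seminorm ℂ (k + (volume : Measure ℝ).integrablePower) 0), ?_,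
          fun r hr x => ?_⟩
        · exact ((hcont _ _).add (hcont _ _)).const_smul c'
        · have := r.integral_pow_mul_iteratedFDeriv_le ℂ volume k 0
          simp only [norm_iteratedFDeriv_zero] at this ⊢
          refine (pow_mul_norm_primitiveIic_le r hr k x).trans (this.trans_eq ?_)
          rw [smul_apply, add_apply, NNReal.smul_def, hc', smul_eq_mul]
      · refine ⟨SchwartzMap.seminorm ℂ (E := ℝ) (F := ℂ) k n, hcont k n, fun r hr x => ?_⟩
        rw [norm_iteratedFDeriv_eq_norm_iteratedDeriv, iteratedDeriv_succ', deriv_primitiveIic]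
        exact r.le_seminorm' ℂ k n x)

lemma primitiveCLM_apply (ψ : 𝓢(ℝ, ℂ)) (hψ : ∫ t, ψ t = 1) (f : 𝓢(ℝ, ℂ)) (x : ℝ) :
    primitiveCLM ψ hψ f x = ∫ t in Iic x, meanFree ψ f t := rfl

lemma derivCLM_primitiveCLM (ψ : 𝓢(ℝ, ℂ)) (hψ : ∫ t, ψ t = 1) (f : 𝓢(ℝ, ℂ)) :
    SchwartzMap.derivCLM ℂ ℂ (primitiveCLM ψ hψ f) = meanFree ψ f := by
  ext x
  exact (hasDerivAt_primitiveIic (meanFree ψ f) x).deriv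

lemma primitiveCLM_derivCLM (ψ : 𝓢(ℝ, ℂ)) (hψ : ∫ t, ψ t = 1) (f : 𝓢(ℝ, ℂ)) :
    primitiveCLM ψ hψ (SchwartzMap.derivCLM ℂ ℂ f) = f := by
  have hlim : ∀ l ≤ Filter.cocompact ℝ, Filter.Tendsto f l (nhds 0) := fun l hl =>
    f.tendsto_cocompact.mono_left hl
  have hd : ∀ x, HasDerivAt f (SchwartzMap.derivCLM ℂ ℂ f x) x := fun x => f.hasDerivAt x
  have h0 : ∫ t, SchwartzMap.derivCLM ℂ ℂ f t = 0 := by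
    rw [integral_of_hasDerivAt_of_tendsto hd
      (SchwartzMap.derivCLM ℂ ℂ f).integrable (hlim _ atBot_le_cocompact)
      (hlim _ atTop_le_cocompact), sub_zero]
  ext x
  rw [primitiveCLM_apply, meanFree_eq_self ψ h0,
    integral_Iic_of_hasDerivAt_of_tendsto' (fun x _ => hd x)
      (SchwartzMap.derivCLM ℂ ℂ f).integrable.integrableOn (hlim _ atBot_le_cocompact), sub_zero]

lemma tsupport_primitiveCLM {ψ : 𝓢(ℝ, ℂ)} (hψ : ∫ t, ψ t = 1) (hψs : tsupport ψ ⊆ Iio 0)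
    {f : 𝓢(ℝ, ℂ)} (hf : tsupport f ⊆ Iio 0) : tsupport (primitiveCLM ψ hψ f) ⊆ Iio 0 := by
  obtain ⟨a, ha, hψa⟩ := tsupport_subset_Iio_iff.1 hψs
  obtain ⟨b, hb, hfb⟩ := tsupport_subset_Iio_iff.1 hf
  refine tsupport_subset_Iio_iff.2 ⟨max a b, max_lt ha hb, fun x hx => ?_⟩
  rw [primitiveCLM_apply, setIntegral_eq_integral_of_forall_compl_eq_zero,
    integral_meanFree hψ]
  intro t ht
  have ht : max a b ≤ t := hx.trans (le_of_lt (not_le.1 ht))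
  change f t - (∫ s, f s) * ψ t = 0
  rw [hψa t ((le_max_left _ _).trans ht), hfb t ((le_max_right _ _).trans ht)]
  simp

/-- There is a real Schwartz function with integral one supported in `(-∞, 0)`. -/
lemma exists_real_unit_mass : ∃ ψ : 𝓢(ℝ, ℂ), (∫ t, ψ t = 1) ∧ tsupport ψ ⊆ Iio 0 ∧
    ∀ x, conj (ψ x) = ψ x := by
  let b : ContDiffBump (-2 : ℝ) := ⟨1 / 2, 1, by norm_num, by norm_num⟩
  have hs : HasCompactSupport fun x => ((b.normed volume x : ℝ) : ℂ) :=
    b.hasCompactSupport_normed.comp_left (g := Complex.ofReal) rfl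
  refine ⟨hs.toSchwartzMap (Complex.ofRealCLM.contDiff.comp b.contDiff_normed), ?_, ?_, ?_⟩
  · change ∫ t, ((b.normed volume t : ℝ) : ℂ) = 1
    rw [integral_complex_ofReal, b.integral_normed, Complex.ofReal_one]
  · have h1 : tsupport (fun x => ((b.normed volume x : ℝ) : ℂ)) ⊆ tsupport (b.normed volume) :=
      closure_mono fun x hx h => hx (by simp [h])
    refine h1.trans ?_
    rw [b.tsupport_normed_eq]
    intro x hx
    rw [Metric.mem_closedBall, Real.dist_eq] at hx
    have := (abs_le.1 hx).2
    change x < 0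
    change _ ≤ (1 : ℝ) at this
    linarith
  · exact fun x => Complex.conj_ofReal _

/-- Multiplying a fixed Schwartz function by a function whose derivatives are
`O(ε (1 + |x|))` produces a Schwartz function of size `O(ε)`. -/
lemma norm_apply_mul_le (d : 𝓢(ℝ, ℂ) →L[ℂ] ℂ) : ∃ n₀ : ℕ, ∀ φ : 𝓢(ℝ, ℂ), ∃ C : ℝ,
    ∀ (m : ℝ → ℂ) (ε : ℝ) (ψ : 𝓢(ℝ, ℂ)), 0 ≤ ε → ContDiff ℝ (⊤ : ℕ∞) m →
      (∀ i ≤ n₀, ∀ x, ‖iteratedDeriv i m x‖ ≤ ε * (1 + ‖x‖)) →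
      (∀ x, ψ x = m x * φ x) → ‖d ψ‖ ≤ C * ε := by
  obtain ⟨s, C, -, hC⟩ := Seminorm.bound_of_continuous (schwartz_withSeminorms ℂ ℝ ℂ)
    ((normSeminorm ℂ ℂ).comp d.toLinearMap) (continuous_norm.comp d.continuous)
  refine ⟨s.sup Prod.snd, fun φ => ?_⟩
  let B : ℕ × ℕ → ℝ := fun q => ∑ i ∈ Finset.range (q.2 + 1), (q.2.choose i : ℝ) *
    (SchwartzMap.seminorm ℂ q.1 (q.2 - i) φ + SchwartzMap.seminorm ℂ (q.1 + 1) (q.2 - i) φ)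
  have hB : ∀ q, 0 ≤ B q := fun q => Finset.sum_nonneg fun i _ => by positivity
  refine ⟨C * ∑ q ∈ s, B q, fun m ε ψ hε hm hmi hψ => ?_⟩
  have h1 : ‖d ψ‖ ≤ C * (s.sup (schwartzSeminormFamily ℂ ℝ ℂ)) ψ := hC ψ
  refine h1.trans ?_
  rw [mul_assoc]
  gcongr
  rw [Finset.sum_mul]
  refine Seminorm.finset_sup_apply_le (Finset.sum_nonneg fun q _ => mul_nonneg (hB q) hε)
    fun q hq => ?_
  refine le_trans ?_ (Finset.single_le_sum (f := fun q => B q * ε)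
    (fun q _ => mul_nonneg (hB q) hε) hq)
  rw [SchwartzMap.schwartzSeminormFamily_apply]
  refine SchwartzMap.seminorm_le_bound ℂ _ _ _ (mul_nonneg (hB q) hε) fun x => ?_
  have hψ' : (ψ : ℝ → ℂ) = fun y => m y * φ y := funext hψ
  rw [hψ']
  calc ‖x‖ ^ q.1 * ‖iteratedFDeriv ℝ q.2 (fun y => m y * φ y) x‖
      ≤ ‖x‖ ^ q.1 * ∑ i ∈ Finset.range (q.2 + 1), (q.2.choose i : ℝ) *
          ‖iteratedFDeriv ℝ i m x‖ * ‖iteratedFDeriv ℝ (q.2 - i) φ x‖ := by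
        gcongr
        exact norm_iteratedFDeriv_mul_le hm (φ.smooth ⊤) x (by exact_mod_cast le_top)
    _ = ∑ i ∈ Finset.range (q.2 + 1), (q.2.choose i : ℝ) *
          (‖iteratedFDeriv ℝ i m x‖ * (‖x‖ ^ q.1 * ‖iteratedFDeriv ℝ (q.2 - i) φ x‖)) := by
        rw [Finset.mul_sum]
        exact Finset.sum_congr rfl fun i _ => by ring
    _ ≤ ∑ i ∈ Finset.range (q.2 + 1), (q.2.choose i : ℝ) *
          ((SchwartzMap.seminorm ℂ q.1 (q.2 - i) φ +
            SchwartzMap.seminorm ℂ (q.1 + 1) (q.2 - i) φ) * ε) := by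
        refine Finset.sum_le_sum fun i hi => mul_le_mul_of_nonneg_left ?_ (by positivity)
        have hi' : i ≤ s.sup Prod.snd :=
          (Nat.lt_succ_iff.1 (Finset.mem_range.1 hi)).trans (Finset.le_sup (f := Prod.snd) hq)
        rw [norm_iteratedFDeriv_eq_norm_iteratedDeriv]
        calc _ ≤ (ε * (1 + ‖x‖)) * (‖x‖ ^ q.1 * ‖iteratedFDeriv ℝ (q.2 - i) φ x‖) := by
              exact mul_le_mul_of_nonneg_right (hmi i hi' x) (by positivity)
          _ = (‖x‖ ^ q.1 * ‖iteratedFDeriv ℝ (q.2 - i) φ x‖ +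
                ‖x‖ ^ (q.1 + 1) * ‖iteratedFDeriv ℝ (q.2 - i) φ x‖) * ε := by ring
          _ ≤ _ := by
              exact mul_le_mul_of_nonneg_right
                (add_le_add (φ.le_seminorm ℂ _ _ x) (φ.le_seminorm ℂ _ _ x)) hε
    _ = B q * ε := by
        rw [Finset.sum_mul]
        exact Finset.sum_congr rfl fun i _ => by ring

/-- Precomposition of a Schwartz function with multiplication by `c ≠ 0`. -/
noncomputable def dilate (c : ℝ) (hc : c ≠ 0) : 𝓢(ℝ, ℂ) →L[ℂ] 𝓢(ℝ, ℂ) :=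
  SchwartzMap.compCLMOfContinuousLinearEquiv ℂ
    (ContinuousLinearEquiv.unitsEquivAut ℝ (Units.mk0 c hc))

lemma dilate_apply (c : ℝ) (hc : c ≠ 0) (φ : 𝓢(ℝ, ℂ)) (x : ℝ) : dilate c hc φ x = φ (c * x) := by
  simp [dilate, SchwartzMap.compCLMOfContinuousLinearEquiv_apply, mul_comm]

lemma norm_iteratedDeriv_dilate (θ : 𝓢(ℝ, ℂ)) (c : ℝ) (i : ℕ) (x : ℝ) :
    ‖iteratedDeriv i (fun y => θ (c * y)) x‖ ≤ |c| ^ i * SchwartzMap.seminorm ℂ 0 i θ := by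
  have h := congrFun (iteratedDeriv_comp_const_smul (n := i) (f := θ) (θ.smooth i) c) x
  rw [h, norm_smul, norm_pow, Real.norm_eq_abs]
  gcongr
  have := θ.le_seminorm' ℂ 0 i (c * x)
  rwa [pow_zero, one_mul] at this

/-- A Schwartz cutoff, equal to one near the origin and with compact support. -/
lemma exists_cutoff : ∃ χ : 𝓢(ℝ, ℂ), HasCompactSupport χ ∧ ∀ x, |x| ≤ 1 → χ x = 1 := by
  let b : ContDiffBump (0 : ℝ) := ⟨1, 2, by norm_num, by norm_num⟩
  have hs : HasCompactSupport fun x => ((b x : ℝ) : ℂ) :=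
    b.hasCompactSupport.comp_left (g := Complex.ofReal) rfl
  refine ⟨hs.toSchwartzMap (Complex.ofRealCLM.contDiff.comp b.contDiff), hs, fun x hx => ?_⟩
  change ((b x : ℝ) : ℂ) = 1
  rw [b.one_of_mem_closedBall (by simpa [Real.dist_eq] using hx), Complex.ofReal_one]

lemma eq_zero_of_forall_norm_le_mul {z : ℂ} {C : ℝ}
    (h : ∀ ε : ℝ, 0 < ε → ε ≤ 1 → ‖z‖ ≤ C * ε) : z = 0 := by
  have hlim : Filter.Tendsto (fun ε : ℝ => C * ε) (nhdsWithin 0 (Ioi 0)) (nhds 0) := by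
    have : Filter.Tendsto (fun ε : ℝ => C * ε) (nhds 0) (nhds (C * 0)) :=
      (continuous_const.mul continuous_id).tendsto 0
    rw [mul_zero] at this
    exact this.mono_left nhdsWithin_le_nhds
  have : ‖z‖ ≤ 0 := by
    refine ge_of_tendsto hlim ?_
    filter_upwards [Ioc_mem_nhdsGT (zero_lt_one' ℝ)] with ε hε
    exact h ε hε.1 hε.2
  exact norm_le_zero_iff.1 this

lemma seminorm_le_sum (θ : 𝓢(ℝ, ℂ)) {i n : ℕ} (hi : i ≤ n) :
    SchwartzMap.seminorm ℂ 0 i θ ≤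
      ∑ j ∈ Finset.range (n + 1), SchwartzMap.seminorm ℂ 0 j θ :=
  Finset.single_le_sum (f := fun j => SchwartzMap.seminorm ℂ 0 j θ)
    (fun _ _ => apply_nonneg _ _) (Finset.mem_range.2 (Nat.lt_succ_of_le hi))

/-- A tempered distribution vanishing on compactly supported functions is zero. -/
lemma apply_eq_zero_of_hasCompactSupport (d : 𝓢(ℝ, ℂ) →L[ℂ] ℂ)
    (hd : ∀ φ : 𝓢(ℝ, ℂ), HasCompactSupport φ → d φ = 0) (φ : 𝓢(ℝ, ℂ)) : d φ = 0 := by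
  obtain ⟨χ, hχs, hχ⟩ := exists_cutoff
  obtain ⟨n₀, h⟩ := norm_apply_mul_le d
  obtain ⟨C, hC⟩ := h φ
  set S := ∑ j ∈ Finset.range (n₀ + 1), SchwartzMap.seminorm ℂ 0 j χ with hS
  have hS0 : 0 ≤ S := Finset.sum_nonneg fun j _ => apply_nonneg _ _
  refine eq_zero_of_forall_norm_le_mul (C := C * (1 + S)) fun ε hε hε1 => ?_
  let χε := dilate ε hε.ne' χ
  let ψ := φ - SchwartzMap.smulLeftCLM ℂ χε φ
  have hψ : ∀ x, ψ x = (1 - χ (ε * x)) * φ x := fun x => by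
    change φ x - SchwartzMap.smulLeftCLM ℂ χε φ x = _
    rw [SchwartzMap.smulLeftCLM_apply_apply χε.hasTemperateGrowth, dilate_apply, smul_eq_mul]
    ring
  have hcs : HasCompactSupport (SchwartzMap.smulLeftCLM ℂ χε φ) := by
    have h1 : HasCompactSupport χε := by
      have : (χε : ℝ → ℂ) = χ ∘ (Homeomorph.mulLeft₀ ε hε.ne') :=
        funext fun x => dilate_apply _ _ _ _
      rw [this]
      exact hχs.comp_homeomorph _
    exact IsCompact.of_isClosed_subset h1 (isClosed_tsupport _)
      ((SchwartzMap.tsupport_smulLeftCLM_subset χε φ).trans inter_subset_right)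
  have hdψ : d ψ = d φ := by rw [map_sub, hd _ hcs, sub_zero]
  rw [← hdψ, mul_assoc]
  refine hC (fun x => 1 - χ (ε * x)) ((1 + S) * ε) ψ (by positivity) ?_ ?_ hψ
  · exact contDiff_const.sub ((χ.smooth ⊤).comp (contDiff_const.mul contDiff_id))
  intro i hi x
  rcases Nat.eq_zero_or_pos i with rfl | hi0
  · rw [iteratedDeriv_zero]
    rcases le_or_gt |ε * x| 1 with hx | hx
    · rw [hχ _ hx, sub_self, norm_zero]
      positivity
    · have h1 : ‖χ (ε * x)‖ ≤ S := (χ.norm_le_seminorm ℂ _).trans (seminorm_le_sum χ hi)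
      rw [abs_mul, abs_of_pos hε] at hx
      calc ‖1 - χ (ε * x)‖ ≤ ‖(1 : ℂ)‖ + ‖χ (ε * x)‖ := norm_sub_le _ _
        _ ≤ (1 + S) * 1 := by rw [norm_one, mul_one]; gcongr
        _ ≤ (1 + S) * (ε * (1 + ‖x‖)) := by
          gcongr
          rw [Real.norm_eq_abs]
          nlinarith
        _ = _ := by ring
  · rw [iteratedDeriv_const_sub hi0, iteratedDeriv_neg, norm_neg]
    refine (norm_iteratedDeriv_dilate χ ε i x).trans ?_
    rw [abs_of_pos hε]
    have h2 : ε ^ i ≤ ε := pow_le_of_le_one hε.le hε1 hi0.ne'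
    calc _ ≤ ε * S := by
          gcongr
          exact seminorm_le_sum χ hi
      _ ≤ ε * (1 + S) * 1 := by rw [mul_one]; gcongr; linarith
      _ ≤ (1 + S) * ε * (1 + ‖x‖) := by
          rw [mul_comm ε]
          gcongr
          linarith [norm_nonneg x]

lemma hasTemperateGrowth_ofReal_pow (N : ℕ) :
    Function.HasTemperateGrowth fun x : ℝ => ((x : ℂ) ^ N) := by
  fun_prop

/-- A tempered distribution supported at the origin is annihilated by a power of the
coordinate. -/
lemma exists_pow_mul_apply_eq_zero (d : 𝓢(ℝ, ℂ) →L[ℂ] ℂ)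
    (hd : ∀ φ : 𝓢(ℝ, ℂ), HasCompactSupport φ → (0 : ℝ) ∉ tsupport φ → d φ = 0) :
    ∃ N : ℕ, ∀ φ ψ : 𝓢(ℝ, ℂ), (∀ x : ℝ, ψ x = (x : ℂ) ^ N * φ x) → d ψ = 0 := by
  obtain ⟨χ, hχs, hχ⟩ := exists_cutoff
  obtain ⟨n₀, h⟩ := norm_apply_mul_le d
  refine ⟨n₀ + 1, fun φ ψ hψ => ?_⟩
  obtain ⟨C, hC⟩ := h φ
  let θ := SchwartzMap.smulLeftCLM ℂ (fun x : ℝ => ((x : ℂ) ^ (n₀ + 1))) χ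
  have hθ : ∀ x : ℝ, θ x = (x : ℂ) ^ (n₀ + 1) * χ x := fun x => by
    rw [SchwartzMap.smulLeftCLM_apply_apply (hasTemperateGrowth_ofReal_pow _), smul_eq_mul]
  set S := ∑ j ∈ Finset.range (n₀ + 1), SchwartzMap.seminorm ℂ 0 j θ with hS
  have hS0 : 0 ≤ S := Finset.sum_nonneg fun j _ => apply_nonneg _ _
  refine eq_zero_of_forall_norm_le_mul (C := C * S) fun ε hε hε1 => ?_
  have hε' : ε⁻¹ ≠ 0 := inv_ne_zero hε.ne'
  let χε := dilate ε⁻¹ hε' χ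
  have hχε : ∀ f : 𝓢(ℝ, ℂ), ∀ x,
      SchwartzMap.smulLeftCLM ℂ χε f x = χ (ε⁻¹ * x) * f x := fun f x => by
    rw [SchwartzMap.smulLeftCLM_apply_apply χε.hasTemperateGrowth, dilate_apply, smul_eq_mul]
  have hloc : d ψ = d (SchwartzMap.smulLeftCLM ℂ χε ψ) := by
    have := apply_eq_zero_of_hasCompactSupport
      (d.comp (ContinuousLinearMap.id ℂ _ - SchwartzMap.smulLeftCLM ℂ χε)) (fun f hf => ?_) ψ
    · exact sub_eq_zero.1 (by simpa using this)
    · refine hd (f - SchwartzMap.smulLeftCLM ℂ χε f) ?_ ?_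
      · refine HasCompactSupport.sub hf ?_
        exact IsCompact.of_isClosed_subset hf (isClosed_tsupport _)
          ((SchwartzMap.tsupport_smulLeftCLM_subset χε f).trans inter_subset_left)
      · rw [notMem_tsupport_iff_eventuallyEq]
        filter_upwards [Metric.ball_mem_nhds (0 : ℝ) hε] with x hx
        rw [Metric.mem_ball, Real.dist_eq, sub_zero] at hx
        change f x - SchwartzMap.smulLeftCLM ℂ χε f x = 0
        rw [hχε, hχ _ ?_, one_mul, sub_self]
        rw [abs_mul, abs_of_pos (inv_pos.2 hε), inv_mul_le_iff₀ hε, mul_one]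
        exact hx.le
  rw [hloc, mul_assoc]
  refine hC (fun x => ((ε ^ (n₀ + 1) : ℝ) : ℂ) * θ (ε⁻¹ * x)) (S * ε) _ (by positivity) ?_ ?_ ?_
  · exact contDiff_const.mul ((θ.smooth ⊤).comp (contDiff_const.mul contDiff_id))
  · intro i hi x
    rw [iteratedDeriv_const_mul_field, norm_mul, Complex.norm_real, norm_pow,
      Real.norm_of_nonneg hε.le]
    calc _ ≤ ε ^ (n₀ + 1) * (|ε⁻¹| ^ i * S) := by
          gcongr
          exact (norm_iteratedDeriv_dilate θ ε⁻¹ i x).trans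
            (by gcongr; exact seminorm_le_sum θ hi)
      _ = ε ^ (n₀ - i) * ε * S := by
          rw [abs_of_pos (inv_pos.2 hε), inv_pow]
          have : ε ^ (n₀ + 1) = ε ^ (n₀ - i) * ε * ε ^ i := by
            rw [← pow_succ, ← pow_add]; congr 1; omega
          rw [this]
          field_simp
      _ ≤ 1 * ε * S := by
          gcongr
          exact pow_le_one₀ hε.le hε1
      _ = S * ε * 1 := by ring
      _ ≤ S * ε * (1 + ‖x‖) := by
          gcongr
          linarith [norm_nonneg x]
  · intro x
    rw [hχε, hψ, hθ]
    have : (ε : ℂ) ≠ 0 := by exact_mod_cast hε.ne'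
    have h1 : ((ε ^ (n₀ + 1) : ℝ) : ℂ) * ((ε⁻¹ * x : ℝ) : ℂ) ^ (n₀ + 1) = (x : ℂ) ^ (n₀ + 1) := by
      push_cast
      rw [← mul_pow, mul_inv_cancel_left₀ this]
    linear_combination -(χ (ε⁻¹ * x) * φ x) * h1

/-- Translation `F ↦ F (· + t)` on Schwartz functions. -/
noncomputable def translateS (t : ℝ) : 𝓢(ℝ, ℂ) →L[ℂ] 𝓢(ℝ, ℂ) := SchwartzMap.compSubConstCLM ℂ (-t)

lemma translateS_apply (t : ℝ) (F : 𝓢(ℝ, ℂ)) (x : ℝ) : translateS t F x = F (x + t) := by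
  rw [translateS, SchwartzMap.compSubConstCLM_apply, sub_neg_eq_add]

/-- Reflection `F ↦ F (-·)` on Schwartz functions. -/
noncomputable def reflect : 𝓢(ℝ, ℂ) →L[ℂ] 𝓢(ℝ, ℂ) := dilate (-1) (by norm_num)

lemma reflect_apply (F : 𝓢(ℝ, ℂ)) (x : ℝ) : reflect F x = F (-x) := by
  rw [reflect, dilate_apply, neg_one_mul]

lemma reflect_reflect (F : 𝓢(ℝ, ℂ)) : reflect (reflect F) = F := by
  ext x
  rw [reflect_apply, reflect_apply, neg_neg]

/-- Complex conjugation on Schwartz functions. -/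
noncomputable def conjS : 𝓢(ℝ, ℂ) →L[ℝ] 𝓢(ℝ, ℂ) :=
  SchwartzMap.postcompCLM (Complex.conjCLE : ℂ →L[ℝ] ℂ)

lemma conjS_apply (F : 𝓢(ℝ, ℂ)) (x : ℝ) : conjS F x = conj (F x) := rfl

lemma fourierInv_apply (F : 𝓢(ℝ, ℂ)) (p : ℝ) : 𝓕⁻ F p = 𝓕 F (-p) := by
  rw [SchwartzMap.fourierInv_coe, SchwartzMap.fourier_coe, Real.fourierInv_eq_fourier_neg]

lemma fourierS_apply (F : 𝓢(ℝ, ℂ)) (p : ℝ) :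
    𝓕 F p = ∫ x, Complex.exp (((-2 * Real.pi * x * p : ℝ) : ℂ) * Complex.I) * F x := by
  rw [SchwartzMap.fourier_coe, Real.fourier_real_eq_integral_exp_smul]
  rfl

lemma fourier_reflect (F : 𝓢(ℝ, ℂ)) : 𝓕 (reflect F) = 𝓕⁻ F := by
  ext p
  rw [fourierInv_apply, fourierS_apply, fourierS_apply, ← integral_neg_eq_self]
  refine integral_congr_ae (.of_forall fun x => ?_)
  simp only [reflect_apply, neg_neg]
  congr 4
  ring

lemma fourierInv_reflect (F : 𝓢(ℝ, ℂ)) : 𝓕⁻ (reflect F) = 𝓕 F := by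
  rw [← fourier_reflect, reflect_reflect]

lemma reflect_fourier (F : 𝓢(ℝ, ℂ)) : reflect (𝓕 F) = 𝓕⁻ F := by
  ext p
  rw [fourierInv_apply, reflect_apply]

lemma fourier_fourier (F : 𝓢(ℝ, ℂ)) : 𝓕 (𝓕 F) = reflect F := by
  rw [← fourierInv_reflect (𝓕 F), reflect_fourier, ← fourier_reflect F,
    FourierTransform.fourierInv_fourier_eq]

lemma fourier_conjS (F : 𝓢(ℝ, ℂ)) : 𝓕 (conjS F) = conjS (𝓕⁻ F) := by
  ext p
  rw [conjS_apply, fourierInv_apply, fourierS_apply, fourierS_apply, ← integral_conj]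
  refine integral_congr_ae (.of_forall fun x => ?_)
  simp only [conjS_apply, map_mul, ← Complex.exp_conj, Complex.conj_ofReal, Complex.conj_I]
  congr 2
  push_cast
  ring

lemma conjS_conjS (F : 𝓢(ℝ, ℂ)) : conjS (conjS F) = F := by
  ext x
  rw [conjS_apply, conjS_apply, Complex.conj_conj]

lemma reflect_conjS (F : 𝓢(ℝ, ℂ)) : reflect (conjS F) = conjS (reflect F) := by
  ext x
  simp only [conjS_apply, reflect_apply]

lemma fourierInv_conjS (F : 𝓢(ℝ, ℂ)) : 𝓕⁻ (conjS F) = conjS (𝓕 F) := by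
  rw [← fourier_reflect, reflect_conjS, fourier_conjS, fourierInv_reflect]

lemma fourier_translateS (t : ℝ) (F : 𝓢(ℝ, ℂ)) (p : ℝ) :
    𝓕 (translateS t F) p = Complex.exp (((2 * Real.pi * t * p : ℝ) : ℂ) * Complex.I) * 𝓕 F p := by
  rw [fourierS_apply, fourierS_apply, ← integral_const_mul, ← integral_sub_right_eq_self _ t]
  refine integral_congr_ae (.of_forall fun x => ?_)
  simp only [translateS_apply, sub_add_cancel]
  rw [← mul_assoc, ← Complex.exp_add]
  congr 2
  push_cast
  ring

lemma fourier_derivCLM (F : 𝓢(ℝ, ℂ)) (p : ℝ) :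
    𝓕 (SchwartzMap.derivCLM ℂ ℂ F) p = 2 * Real.pi * Complex.I * (p * 𝓕 F p) := by
  have h := congrFun (Real.fourier_deriv F.integrable F.differentiable
    (SchwartzMap.derivCLM ℂ ℂ F).integrable) p
  rw [SchwartzMap.fourier_coe, SchwartzMap.fourier_coe]
  refine (Eq.trans ?_ h).trans ?_
  · rfl
  · simp only [smul_eq_mul]
    ring

lemma fourierInv_derivCLM (F : 𝓢(ℝ, ℂ)) (p : ℝ) :
    𝓕⁻ (SchwartzMap.derivCLM ℂ ℂ F) p = -(2 * Real.pi * Complex.I * (p * 𝓕⁻ F p)) := by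
  rw [fourierInv_apply, fourier_derivCLM, ← fourierInv_apply]
  push_cast
  ring

lemma fourier_mul_coord {h k : 𝓢(ℝ, ℂ)} (hk : ∀ x : ℝ, h x = x * k x) :
    SchwartzMap.derivCLM ℂ ℂ (𝓕 k) = (-(2 * Real.pi * Complex.I)) • 𝓕 h := by
  rw [← FourierTransform.fourier_fourierInv_eq (E := 𝓢(ℝ, ℂ)) (F := 𝓢(ℝ, ℂ))
    (SchwartzMap.derivCLM ℂ ℂ (𝓕 k)), ← FourierTransform.fourier_smul]
  congr 1
  ext p
  rw [fourierInv_derivCLM, FourierTransform.fourierInv_fourier_eq, _root_.smul_apply, hk,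
    smul_eq_mul]
  ring

lemma tendsto_inner_fourier_translateS (g : Lp ℂ 2 muW) (F : 𝓢(ℝ, ℂ)) :
    Filter.Tendsto (fun t => inner ℂ g (toH (𝓕 (translateS t F)))) (Filter.cocompact ℝ)
      (nhds 0) := by
  have h := Real.tendsto_integral_exp_smul_cocompact
    ((Ioi (0 : ℝ)).indicator fun p => (p : ℂ) * (conj (g p) * 𝓕 F p))
  have h2 := h.comp (Homeomorph.neg ℝ).isClosedEmbedding.tendsto_cocompact
  refine h2.congr fun t => ?_
  rw [inner_toH, ← integral_indicator measurableSet_Ioi]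
  refine integral_congr_ae (.of_forall fun p => ?_)
  simp only [Homeomorph.coe_neg]
  by_cases hp : p ∈ Ioi (0 : ℝ)
  · simp only [indicator_of_mem hp, fourier_translateS]
    rw [Circle.smul_def, Real.fourierChar_apply, smul_eq_mul]
    have : ((2 * Real.pi * -(p * -t) : ℝ) : ℂ) = ((2 * Real.pi * t * p : ℝ) : ℂ) := by
      congr 1; ring
    rw [this]
    ring
  · simp only [indicator_of_notMem hp, smul_zero]

lemma tendsto_inner_fourierInv_translate (g : Lp ℂ 2 muW) (F : 𝓢(ℝ, ℂ)) :
    Filter.Tendsto (fun t => inner ℂ g (toH (𝓕⁻ (translateS t F)))) (Filter.cocompact ℝ)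
      (nhds 0) := by
  refine ((tendsto_inner_fourier_translateS g (reflect F)).comp
    (Homeomorph.neg ℝ).isClosedEmbedding.tendsto_cocompact).congr fun t => ?_
  have : translateS (-t) (reflect F) = reflect (translateS t F) := by
    ext x
    simp only [translateS_apply, reflect_apply]
    congr 1
    ring
  simp only [Function.comp, Homeomorph.coe_neg, this, fourier_reflect]

/-- The obstruction to `g` belonging to `Hzero`, as a tempered distribution. -/
noncomputable def defect (g : Lp ℂ 2 muW) : 𝓢(ℝ, ℂ) →L[ℂ] ℂ :=
  (innerSL ℂ (star g)).comp (toH.comp (FourierTransform.fourierInvCLM ℂ 𝓢(ℝ, ℂ))) -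
    (innerSL ℂ g).comp (toH.comp (FourierTransform.fourierCLM ℂ 𝓢(ℝ, ℂ)))

lemma defect_apply (g : Lp ℂ 2 muW) (F : 𝓢(ℝ, ℂ)) :
    defect g F = inner ℂ (star g) (toH (𝓕⁻ F)) - inner ℂ g (toH (𝓕 F)) := rfl

lemma inner_star_toH_conjS (g : Lp ℂ 2 muW) (φ : 𝓢(ℝ, ℂ)) :
    inner ℂ (star g) (toH (conjS φ)) = conj (inner ℂ g (toH φ)) := by
  rw [inner_star_toH, inner_toH, ← integral_conj]
  simp [conjS_apply]

lemma inner_toH_conjS (g : Lp ℂ 2 muW) (φ : 𝓢(ℝ, ℂ)) :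
    inner ℂ g (toH (conjS φ)) = conj (inner ℂ (star g) (toH φ)) := by
  rw [inner_star_toH, inner_toH, ← integral_conj]
  simp [conjS_apply]

lemma defect_conjS (g : Lp ℂ 2 muW) (F : 𝓢(ℝ, ℂ)) :
    defect g (conjS F) = -conj (defect g F) := by
  rw [defect_apply, defect_apply, fourierInv_conjS, fourier_conjS, inner_star_toH_conjS,
    inner_toH_conjS, map_sub]
  ring

lemma tendsto_defect_translate (g : Lp ℂ 2 muW) (F : 𝓢(ℝ, ℂ)) :
    Filter.Tendsto (fun t => defect g (translateS t F)) Filter.atTop (nhds 0) := by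
  have h := ((tendsto_inner_fourierInv_translate (star g) F).sub
    (tendsto_inner_fourier_translateS g F)).mono_left atTop_le_cocompact
  rwa [sub_zero] at h

lemma tsupport_derivCLM {F : 𝓢(ℝ, ℂ)} {s : Set ℝ} (hF : tsupport F ⊆ s) :
    tsupport (SchwartzMap.derivCLM ℂ ℂ F) ⊆ s :=
  (SchwartzMap.tsupport_derivCLM_subset ℂ F).trans hF

lemma tsupport_iterate_derivCLM {F : 𝓢(ℝ, ℂ)} {s : Set ℝ} (hF : tsupport F ⊆ s) (N : ℕ) :
    tsupport ((SchwartzMap.derivCLM ℂ ℂ)^[N] F) ⊆ s := by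
  induction N generalizing F with
  | zero => exact hF
  | succ N ih => exact ih (tsupport_derivCLM hF)

lemma translateS_derivCLM (t : ℝ) (F : 𝓢(ℝ, ℂ)) :
    translateS t (SchwartzMap.derivCLM ℂ ℂ F) = SchwartzMap.derivCLM ℂ ℂ (translateS t F) := by
  ext x
  rw [translateS_apply, SchwartzMap.derivCLM_apply, SchwartzMap.derivCLM_apply]
  have : (translateS t F : ℝ → ℂ) = fun y => F (y + t) := funext fun y => translateS_apply t F y
  rw [this, deriv_comp_add_const]

lemma translateS_iterate_derivCLM (t : ℝ) (N : ℕ) (F : 𝓢(ℝ, ℂ)) :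
    translateS t ((SchwartzMap.derivCLM ℂ ℂ)^[N] F) =
      (SchwartzMap.derivCLM ℂ ℂ)^[N] (translateS t F) :=
  (Function.Commute.iterate_right (f := translateS t) (g := SchwartzMap.derivCLM ℂ ℂ)
    (fun F => translateS_derivCLM t F) N) F

lemma tsupport_translateS {t : ℝ} (ht : 0 ≤ t) {F : 𝓢(ℝ, ℂ)} (hF : tsupport F ⊆ Iio 0) :
    tsupport (translateS t F) ⊆ Iio 0 := by
  obtain ⟨a, ha, h⟩ := tsupport_subset_Iio_iff.1 hF
  exact tsupport_subset_Iio_iff.2 ⟨a, ha, fun x hx => by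
    rw [translateS_apply]; exact h _ (by linarith)⟩

/-- A functional decaying along translations, some derivative of which is supported in
`[0,∞)`, is itself supported in `[0,∞)`. -/
lemma apply_eq_zero_of_iterate_derivCLM (v : 𝓢(ℝ, ℂ) →L[ℂ] ℂ)
    (hv : ∀ F, Filter.Tendsto (fun t => v (translateS t F)) Filter.atTop (nhds 0)) (N : ℕ)
    (h : ∀ F : 𝓢(ℝ, ℂ), tsupport F ⊆ Iio 0 → v ((SchwartzMap.derivCLM ℂ ℂ)^[N] F) = 0)
    (F : 𝓢(ℝ, ℂ)) (hF : tsupport F ⊆ Iio 0) : v F = 0 := by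
  induction N with
  | zero => exact h F hF
  | succ N ih =>
    refine ih fun F hF => ?_
    obtain ⟨ψ, hψ, hψs, -⟩ := exists_real_unit_mass
    refine tendsto_nhds_unique_of_eventuallyEq tendsto_const_nhds
      (hv ((SchwartzMap.derivCLM ℂ ℂ)^[N] F)) ?_
    filter_upwards [Filter.eventually_ge_atTop 0] with t ht
    have hs : tsupport (translateS t F - F : 𝓢(ℝ, ℂ)) ⊆ Iio 0 :=
      (tsupport_sub _ _).trans (union_subset (tsupport_translateS ht hF) hF)
    have hint : ∫ x, (translateS t F - F) x = 0 := by
      have h1 : ∀ x, (translateS t F - F) x = F (x + t) - F x := fun x => by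
        rw [sub_apply, translateS_apply]
      simp_rw [h1]
      rw [integral_sub (F.integrable.comp_add_right t) F.integrable,
        integral_add_right_eq_self (fun x => F x), sub_self]
    have h2 := h _ (tsupport_primitiveCLM hψ hψs hs)
    rw [Function.iterate_succ_apply, derivCLM_primitiveCLM, meanFree_eq_self ψ hint,
      iterate_map_sub, map_sub, sub_eq_zero] at h2
    rw [translateS_iterate_derivCLM, h2]

/-- Multiplication of a Schwartz function by the coordinate. -/
noncomputable def coordMul : 𝓢(ℝ, ℂ) →L[ℂ] 𝓢(ℝ, ℂ) :=
  SchwartzMap.smulLeftCLM ℂ fun x : ℝ => (x : ℂ)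

lemma coordMul_apply (φ : 𝓢(ℝ, ℂ)) (x : ℝ) : coordMul φ x = x * φ x := by
  rw [coordMul, SchwartzMap.smulLeftCLM_apply_apply (by fun_prop), smul_eq_mul]

/-- The restriction to `(0,∞)` of a compactly supported function vanishing near `0`. -/
lemma exists_restrict_Ioi {φ : 𝓢(ℝ, ℂ)} (hφ : HasCompactSupport φ) (h0 : (0 : ℝ) ∉ tsupport φ) :
    ∃ θ : 𝓢(ℝ, ℂ), HasCompactSupport θ ∧ tsupport θ ⊆ Ioi 0 ∧ (∀ x, 0 < x → θ x = φ x) ∧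
      ∀ x ≤ 0, θ x = 0 := by
  have hsub : tsupport ((Ioi (0 : ℝ)).indicator φ) ⊆ tsupport φ :=
    closure_mono (by rw [support_indicator]; exact inter_subset_right)
  have hsub' : tsupport ((Ioi (0 : ℝ)).indicator φ) ⊆ Ici 0 :=
    closure_minimal (by
      rw [support_indicator]; exact inter_subset_left.trans Ioi_subset_Ici_self)
      isClosed_Ici
  have hs : HasCompactSupport ((Ioi (0 : ℝ)).indicator φ) :=
    IsCompact.of_isClosed_subset hφ (isClosed_tsupport _) hsub
  have hsm : ContDiff ℝ (⊤ : ℕ∞) ((Ioi (0 : ℝ)).indicator φ) := by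
    refine contDiff_iff_contDiffAt.2 fun x => ?_
    by_cases hx : x ∈ tsupport φ
    · rcases lt_trichotomy x 0 with hx0 | rfl | hx0
      · refine contDiffAt_const (c := (0 : ℂ)) |>.congr_of_eventuallyEq ?_
        filter_upwards [Iio_mem_nhds hx0] with y hy
        exact indicator_of_notMem (not_lt.2 (le_of_lt hy)) _
      · exact absurd hx h0
      · refine (φ.smooth ⊤).contDiffAt.congr_of_eventuallyEq ?_
        filter_upwards [Ioi_mem_nhds hx0] with y hy
        exact indicator_of_mem hy _
    · refine contDiffAt_const (c := (0 : ℂ)) |>.congr_of_eventuallyEq ?_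
      exact notMem_tsupport_iff_eventuallyEq.1 fun h => hx (hsub h)
  refine ⟨hs.toSchwartzMap hsm, hs, fun x hx => ?_, fun x hx => indicator_of_mem hx _,
    fun x hx => indicator_of_notMem (not_lt.2 hx) _⟩
  have h1 : 0 ≤ x := hsub' hx
  exact lt_of_le_of_ne h1 fun h => h0 (h ▸ hsub hx)

lemma exists_add_reflect {φ : 𝓢(ℝ, ℂ)} (hφ : HasCompactSupport φ)
    (h0 : (0 : ℝ) ∉ tsupport φ) :
    ∃ θ₁ θ₂ : 𝓢(ℝ, ℂ), φ = θ₁ + reflect θ₂ ∧ HasCompactSupport θ₁ ∧ HasCompactSupport θ₂ ∧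
      tsupport θ₁ ⊆ Ioi 0 ∧ tsupport θ₂ ⊆ Ioi 0 := by
  have hr : (reflect φ : ℝ → ℂ) = φ ∘ Homeomorph.neg ℝ := funext fun x => reflect_apply φ x
  have h0r : (0 : ℝ) ∉ tsupport (reflect φ) := by
    rw [hr, tsupport_comp_eq_preimage]
    simpa using h0
  obtain ⟨θ₁, hc₁, hs₁, he₁, hz₁⟩ := exists_restrict_Ioi hφ h0
  obtain ⟨θ₂, hc₂, hs₂, he₂, hz₂⟩ :=
    exists_restrict_Ioi (φ := reflect φ) (hr ▸ hφ.comp_homeomorph _) h0r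
  refine ⟨θ₁, θ₂, ?_, hc₁, hc₂, hs₁, hs₂⟩
  ext x
  rw [add_apply, reflect_apply]
  rcases lt_trichotomy x 0 with hx | rfl | hx
  · rw [hz₁ x hx.le, he₂ _ (neg_pos.2 hx), reflect_apply, neg_neg, zero_add]
  · rw [hz₁ 0 le_rfl, hz₂ _ neg_zero.le, image_eq_zero_of_notMem_tsupport h0, zero_add]
  · rw [he₁ x hx, hz₂ _ (neg_nonpos.2 hx.le), add_zero]

lemma inner_toH_eq_zero (g : Lp ℂ 2 muW) {φ : 𝓢(ℝ, ℂ)} (h : ∀ x, 0 < x → φ x = 0) :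
    inner ℂ g (toH φ) = 0 := by
  rw [inner_toH]
  exact setIntegral_eq_zero_of_forall_eq_zero fun x hx => by rw [h x hx, mul_zero, mul_zero]

lemma apply_neg_eq_zero_of_tsupport {θ : 𝓢(ℝ, ℂ)} (h : tsupport θ ⊆ Ioi 0) (x : ℝ)
    (hx : 0 < x) : reflect θ x = 0 := by
  rw [reflect_apply]
  exact image_eq_zero_of_notMem_tsupport fun hm => lt_asymm hx (neg_pos.1 (h hm))

/-- Elements of `Hzero` have vanishing defect on functions supported in `(-∞,0)`. -/
lemma defect_eq_zero_of_mem {g : Lp ℂ 2 muW} (hg : g ∈ Hzero) (F : 𝓢(ℝ, ℂ))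
    (hF : tsupport F ⊆ Iio 0) : defect g F = 0 := by
  obtain ⟨u, hreal, hsupp, hu⟩ := hg
  simp only [SchwartzMap.fourierTransformCLM_apply] at hu
  have hts : ∀ θ : 𝓢(ℝ, ℂ), tsupport (coordMul θ) ⊆ tsupport θ := fun θ =>
    (SchwartzMap.tsupport_smulLeftCLM_subset _ θ).trans inter_subset_left
  have hpos : ∀ θ : 𝓢(ℝ, ℂ), HasCompactSupport θ → tsupport θ ⊆ Ioi 0 →
      u (𝓕 (coordMul θ)) = inner ℂ (star g) (toH θ) := fun θ hc hs => by
    rw [hu _ (IsCompact.of_isClosed_subset hc (isClosed_tsupport _) (hts θ)) ((hts θ).trans hs),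
      inner_star_toH]
    refine integral_congr_ae (.of_forall fun p => ?_)
    simp only [coordMul_apply]
    ring
  have hneg : ∀ θ : 𝓢(ℝ, ℂ), HasCompactSupport θ → tsupport θ ⊆ Ioi 0 →
      u (𝓕 (coordMul (reflect θ))) = -inner ℂ g (toH θ) := fun θ hc hs => by
    have h1 : 𝓕 (coordMul (reflect θ)) = -conjS (𝓕 (coordMul (conjS θ))) := by
      rw [← fourierInv_conjS, ← fourier_reflect, ← FourierTransform.fourier_neg]
      congr 1
      ext x
      simp [coordMul_apply, reflect_apply, conjS_apply]
    have hsup : Function.support (conjS θ) = Function.support θ := by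
      ext x; simp [conjS_apply]
    have hts' : tsupport (conjS θ) = tsupport θ := congrArg closure hsup
    rw [h1, map_neg, hreal _ _ (conjS_apply _), hpos _ (by rwa [HasCompactSupport, hts'])
      (by rwa [hts']), inner_star_toH_conjS, Complex.conj_conj]
  let d : 𝓢(ℝ, ℂ) →L[ℂ] ℂ := u.comp ((FourierTransform.fourierCLM ℂ 𝓢(ℝ, ℂ)).comp coordMul) -
    (innerSL ℂ (star g)).comp toH + (innerSL ℂ g).comp (toH.comp reflect)
  have hd : ∀ φ, d φ =
      u (𝓕 (coordMul φ)) - inner ℂ (star g) (toH φ) + inner ℂ g (toH (reflect φ)) :=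
    fun φ => rfl
  obtain ⟨N, hN⟩ := exists_pow_mul_apply_eq_zero d fun φ hc h0 => by
    obtain ⟨θ₁, θ₂, rfl, hc₁, hc₂, hs₁, hs₂⟩ := exists_add_reflect hc h0
    rw [map_add, hd, hd, hpos _ hc₁ hs₁, hneg _ hc₂ hs₂, reflect_reflect,
      inner_toH_eq_zero g (apply_neg_eq_zero_of_tsupport hs₁),
      inner_toH_eq_zero (star g) (apply_neg_eq_zero_of_tsupport hs₂)]
    ring
  refine apply_eq_zero_of_iterate_derivCLM _ (tendsto_defect_translate g) N (fun F hF => ?_) F hF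
  have hpow : ∀ (N : ℕ) (F : 𝓢(ℝ, ℂ)) (p : ℝ), 𝓕⁻ ((SchwartzMap.derivCLM ℂ ℂ)^[N] F) p =
      (p : ℂ) ^ N * ((-(2 * Real.pi * Complex.I)) ^ N • 𝓕⁻ F) p := by
    intro N
    induction N with
    | zero => intro F p; simp
    | succ N ih =>
      intro F p
      rw [Function.iterate_succ_apply, ih, smul_apply, smul_apply, fourierInv_derivCLM,
        smul_eq_mul, smul_eq_mul]
      ring
  have h0 := hN _ _ (hpow N F)
  set G := (SchwartzMap.derivCLM ℂ ℂ)^[N] F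
  have hu0 : u (𝓕 (coordMul (𝓕⁻ G))) = 0 := by
    have h1 : SchwartzMap.derivCLM ℂ ℂ G = (-(2 * Real.pi * Complex.I)) • 𝓕 (coordMul (𝓕⁻ G)) := by
      rw [← fourier_mul_coord (coordMul_apply _), FourierTransform.fourier_fourierInv_eq]
    have h2 := hsupp _ (tsupport_derivCLM (tsupport_iterate_derivCLM hF N))
    rw [h1, map_smul, smul_eq_mul] at h2
    exact (mul_eq_zero.1 h2).resolve_left (by simp [Real.pi_ne_zero])
  have h3 : reflect (𝓕⁻ G) = 𝓕 G := by rw [← reflect_fourier, reflect_reflect]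
  rw [hd, hu0, h3] at h0
  rw [defect_apply]
  linear_combination -h0

lemma primitiveCLM_conjS {ψ : 𝓢(ℝ, ℂ)} (hψ : ∫ t, ψ t = 1) (hψr : ∀ x, conj (ψ x) = ψ x)
    (f : 𝓢(ℝ, ℂ)) : primitiveCLM ψ hψ (conjS f) = conjS (primitiveCLM ψ hψ f) := by
  have h : meanFree ψ (conjS f) = conjS (meanFree ψ f) := by
    ext x
    simp only [meanFree_apply, sub_apply, smul_apply, conjS_apply, smul_eq_mul, map_sub, map_mul,
      hψr, integral_conj]
  ext x
  rw [conjS_apply, primitiveCLM_apply, primitiveCLM_apply, h, ← integral_conj]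
  rfl

lemma exists_coordMul_eq {h : 𝓢(ℝ, ℂ)} (hc : HasCompactSupport h) (hs : tsupport h ⊆ Ioi 0) :
    ∃ k : 𝓢(ℝ, ℂ), (∀ x : ℝ, h x = x * k x) ∧ tsupport k ⊆ Ioi 0 := by
  have hts : tsupport (fun x : ℝ => (x : ℂ)⁻¹ * h x) ⊆ tsupport h :=
    closure_mono fun x hx => right_ne_zero_of_mul hx
  have hc' : HasCompactSupport (fun x : ℝ => (x : ℂ)⁻¹ * h x) :=
    IsCompact.of_isClosed_subset hc (isClosed_tsupport _) hts
  have hsm : ContDiff ℝ (⊤ : ℕ∞) (fun x : ℝ => (x : ℂ)⁻¹ * h x) := by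
    refine contDiff_iff_contDiffAt.2 fun x => ?_
    by_cases hx : x ∈ tsupport h
    · have hx0 : (x : ℂ) ≠ 0 := Complex.ofReal_ne_zero.2 (ne_of_gt (hs hx))
      exact (Complex.ofRealCLM.contDiff.contDiffAt.inv hx0).mul (h.smooth ⊤).contDiffAt
    · refine contDiffAt_const (c := (0 : ℂ)) |>.congr_of_eventuallyEq ?_
      exact notMem_tsupport_iff_eventuallyEq.1 fun h => hx (hts h)
  refine ⟨hc'.toSchwartzMap hsm, fun x => ?_, hts.trans hs⟩
  change h x = x * ((x : ℂ)⁻¹ * h x)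
  rcases eq_or_ne x 0 with rfl | hx
  · rw [image_eq_zero_of_notMem_tsupport fun hm => lt_irrefl (0 : ℝ) (hs hm)]
    simp
  · rw [mul_inv_cancel_left₀ (Complex.ofReal_ne_zero.2 hx)]

lemma mem_Hzero_iff {g : Lp ℂ 2 muW} :
    g ∈ Hzero ↔ ∀ F : 𝓢(ℝ, ℂ), tsupport F ⊆ Iio 0 → defect g F = 0 := by
  refine ⟨fun hg F hF => defect_eq_zero_of_mem hg F hF, fun hg => ?_⟩
  obtain ⟨ψ, hψ, hψs, hψr⟩ := exists_real_unit_mass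
  refine ⟨(-(2 * Real.pi * Complex.I)) • (defect g).comp (primitiveCLM ψ hψ), fun h h' hh => ?_,
    fun h hs => ?_, fun h hc hs => ?_⟩
  · obtain rfl : h' = conjS h := by
      ext x
      exact hh x
    simp only [smul_apply, ContinuousLinearMap.comp_apply, primitiveCLM_conjS hψ hψr,
      defect_conjS, smul_eq_mul, map_mul, map_neg, Complex.conj_I, Complex.conj_ofReal,
      map_ofNat]
    ring
  · simp only [smul_apply, ContinuousLinearMap.comp_apply,
      hg _ (tsupport_primitiveCLM hψ hψs hs), smul_zero]
  · obtain ⟨k, hk, hks⟩ := exists_coordMul_eq hc hs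
    rw [SchwartzMap.fourierTransformCLM_apply, smul_apply, ContinuousLinearMap.comp_apply,
      ← map_smul, ← map_smul, ← fourier_mul_coord hk, primitiveCLM_derivCLM,
      defect_apply, FourierTransform.fourierInv_fourier_eq, fourier_fourier,
      inner_toH_eq_zero g (apply_neg_eq_zero_of_tsupport hks), sub_zero, inner_star_toH]
    refine integral_congr_ae (.of_forall fun p => ?_)
    simp only [hk]
    ring

/-- The `n`-th Stieltjes-type transform of a function on `(0,∞)`. -/
noncomputable def stieltjes (K : ℝ → ℂ) (n : ℕ) (z : ℂ) : ℂ :=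
  ∫ p in Ioi (0 : ℝ), K p * (((p : ℂ) + z) ^ (n + 1))⁻¹

lemma half_sub_le_norm_add {p : ℝ} (hp : 0 < p) (z : ℂ) : (z.re - z.im) / 2 ≤ ‖(p : ℂ) + z‖ := by
  have h1 := (le_abs_self _).trans (Complex.abs_re_le_norm ((p : ℂ) + z))
  have h2 := (neg_le_abs _).trans (Complex.abs_im_le_norm ((p : ℂ) + z))
  simp only [Complex.add_re, Complex.add_im, Complex.ofReal_re, Complex.ofReal_im] at h1 h2
  linarith

lemma add_ne_zero_of_im_lt_re {p : ℝ} (hp : 0 < p) {z : ℂ} (hz : z.im < z.re) :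
    (p : ℂ) + z ≠ 0 :=
  norm_pos_iff.1 (lt_of_lt_of_le (by linarith) (half_sub_le_norm_add hp z))

lemma norm_inv_add_pow_le {p δ : ℝ} (hp : 0 < p) (hδ : 0 < δ) {z : ℂ} (hz : δ ≤ z.re - z.im)
    (n : ℕ) : ‖(((p : ℂ) + z) ^ n)⁻¹‖ ≤ ((δ / 2) ^ n)⁻¹ := by
  rw [norm_inv, norm_pow]
  gcongr
  exact le_trans (by linarith) (half_sub_le_norm_add hp z)

lemma aestronglyMeasurable_stieltjes {K : ℝ → ℂ} (hK : IntegrableOn K (Ioi 0)) (n : ℕ) (z : ℂ) :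
    AEStronglyMeasurable (fun p : ℝ => K p * (((p : ℂ) + z) ^ n)⁻¹)
      (volume.restrict (Ioi 0)) :=
  hK.aestronglyMeasurable.mul (by fun_prop : Measurable fun p : ℝ =>
    (((p : ℂ) + z) ^ n)⁻¹).aestronglyMeasurable

lemma integrableOn_stieltjes {K : ℝ → ℂ} (hK : IntegrableOn K (Ioi 0)) (n : ℕ) {z : ℂ}
    (hz : z.im < z.re) :
    IntegrableOn (fun p : ℝ => K p * (((p : ℂ) + z) ^ n)⁻¹) (Ioi 0) := by
  refine (hK.norm.mul_const (((z.re - z.im) / 2) ^ n)⁻¹).mono'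
    (aestronglyMeasurable_stieltjes hK n z) ?_
  filter_upwards [ae_restrict_mem measurableSet_Ioi] with p hp
  rw [norm_mul]
  gcongr
  exact norm_inv_add_pow_le hp (sub_pos.2 hz) le_rfl n

lemma hasDerivAt_stieltjes {K : ℝ → ℂ} (hK : IntegrableOn K (Ioi 0)) (n : ℕ) {z : ℂ}
    (hz : z.im < z.re) :
    HasDerivAt (stieltjes K n) (-(n + 1) * stieltjes K (n + 1) z) z := by
  have hs : {w : ℂ | (z.re - z.im) / 2 < w.re - w.im} ∈ nhds z :=
    (isOpen_lt continuous_const (by fun_prop)).mem_nhds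
      (by simp only [mem_ofPred_eq]; linarith)
  have hδ : 0 < (z.re - z.im) / 2 := by linarith
  have key := (hasDerivAt_integral_of_dominated_loc_of_deriv_le
    (μ := volume.restrict (Ioi (0 : ℝ)))
    (F := fun (w : ℂ) (p : ℝ) => K p * (((p : ℂ) + w) ^ (n + 1))⁻¹)
    (F' := fun (w : ℂ) (p : ℝ) => -(n + 1) * (K p * (((p : ℂ) + w) ^ (n + 1 + 1))⁻¹))
    (bound := fun p => (n + 1) * (‖K p‖ * (((z.re - z.im) / 2 / 2) ^ (n + 1 + 1))⁻¹))
    hs (.of_forall fun w => aestronglyMeasurable_stieltjes hK _ w)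
    (integrableOn_stieltjes hK _ hz) ((aestronglyMeasurable_stieltjes hK _ z).const_mul _)
    ?_ ((hK.norm.mul_const _).const_mul _) ?_).2
  · rw [integral_const_mul] at key
    exact key
  · filter_upwards [ae_restrict_mem measurableSet_Ioi] with p hp w hw
    have h1 : ‖(-((n : ℂ) + 1))‖ = n + 1 := by
      rw [norm_neg]
      exact_mod_cast Complex.norm_natCast (n + 1)
    rw [norm_mul, norm_mul, h1]
    gcongr
    exact norm_inv_add_pow_le hp hδ (le_of_lt hw) _
  · filter_upwards [ae_restrict_mem measurableSet_Ioi] with p hp w hw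
    have hw' : w.im < w.re := by
      have : (z.re - z.im) / 2 < w.re - w.im := hw
      linarith
    have hne := add_ne_zero_of_im_lt_re hp hw'
    have h := ((((hasDerivAt_id w).const_add (p : ℂ)).fun_pow (n + 1)).fun_inv
      (pow_ne_zero _ hne)).const_mul (K p)
    refine h.congr_deriv ?_
    rw [add_tsub_cancel_right, id]
    push_cast
    field_simp
    ring

lemma stieltjes_eq_zero {K : ℝ → ℂ} (hK : IntegrableOn K (Ioi 0))
    (h0 : ∀ z : ℂ, z.im < 0 → 0 < z.re → stieltjes K 0 z = 0) (n : ℕ) {z : ℂ} (hz : z.im < z.re) :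
    stieltjes K n z = 0 := by
  have hopen : IsOpen {w : ℂ | w.im < w.re} := isOpen_lt (by fun_prop) (by fun_prop)
  induction n generalizing z with
  | zero =>
    have han : AnalyticOnNhd ℂ (stieltjes K 0) {w : ℂ | w.im < w.re} :=
      DifferentiableOn.analyticOnNhd (fun w hw =>
        (hasDerivAt_stieltjes hK 0 hw).differentiableAt.differentiableWithinAt) hopen
    have hconv : Convex ℝ {w : ℂ | w.im < w.re} := by
      have : {w : ℂ | w.im < w.re} = {w | (Complex.imLm - Complex.reLm) w < 0} := by
        ext w; simp
      rw [this]
      exact convex_halfSpace_lt (LinearMap.isLinear _) 0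
    refine han.eqOn_zero_of_preconnected_of_eventuallyEq_zero hconv.isPreconnected
      (z₀ := 1 - Complex.I) (by norm_num) ?_ hz
    have h1 : {w : ℂ | w.im < 0} ∈ nhds (1 - Complex.I) :=
      (isOpen_lt (by fun_prop) (by fun_prop)).mem_nhds (by simp)
    have h2 : {w : ℂ | 0 < w.re} ∈ nhds (1 - Complex.I) :=
      (isOpen_lt (by fun_prop) (by fun_prop)).mem_nhds (by simp)
    filter_upwards [h1, h2] with w hw1 hw2
    exact h0 w hw1 hw2
  | succ n ih =>
    have h1 := hasDerivAt_stieltjes hK n hz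
    have h2 : HasDerivAt (stieltjes K n) 0 z :=
      (hasDerivAt_const z (0 : ℂ)).congr_of_eventuallyEq
        (Filter.eventually_of_mem (hopen.mem_nhds hz) fun w hw => ih hw)
    have h3 := h1.unique h2
    exact (mul_eq_zero.1 h3).resolve_left (neg_ne_zero.2 (by exact_mod_cast n.succ_ne_zero))

lemma stieltjes_zero_eq_zero {K : ℝ → ℂ} (hK : IntegrableOn K (Ioi 0))
    (h : ∀ t : ℝ, 0 ≤ t →
      ∫ p in Ioi (0 : ℝ), Complex.exp (((-2 * Real.pi * t * p : ℝ) : ℂ) * Complex.I) * K p = 0)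
    {z : ℂ} (hz : z.im < 0) (hzre : 0 < z.re) : stieltjes K 0 z = 0 := by
  set c : ℂ := 2 * Real.pi * Complex.I with hc
  have hc0 : c ≠ 0 := by simp [hc, Real.pi_ne_zero]
  have hre : ∀ p : ℝ, (-(c * (p + z))).re < 0 := fun p => by
    have : (-(c * (p + z))).re = 2 * Real.pi * z.im := by simp [hc]
    rw [this]
    exact mul_neg_of_pos_of_neg (by positivity) hz
  have hint : Integrable (Function.uncurry fun (t p : ℝ) =>
      Complex.exp (((-2 * Real.pi * t * p : ℝ) : ℂ) * Complex.I) *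
        (Complex.exp (-(c * z) * t) * K p))
      ((volume.restrict (Ioi 0)).prod (volume.restrict (Ioi 0))) := by
    have h1 : IntegrableOn (fun t : ℝ => Complex.exp (-(c * z) * t)) (Ioi 0) :=
      integrableOn_exp_mul_complex_Ioi (by simpa using hre 0) 0
    refine (h1.mul_prod hK).bdd_mul (c := 1) (by fun_prop) (.of_forall fun q => ?_)
    rw [Complex.norm_exp_ofReal_mul_I]
  have hswap := integral_integral_swap hint
  have hl : ∀ t ∈ Ioi (0 : ℝ), ∫ p in Ioi (0 : ℝ),
      Complex.exp (((-2 * Real.pi * t * p : ℝ) : ℂ) * Complex.I) *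
        (Complex.exp (-(c * z) * t) * K p) = 0 := fun t ht => by
    have h2 := congrArg (Complex.exp (-(c * z) * t) * ·) (h t (le_of_lt ht))
    simp only [mul_zero, ← integral_const_mul] at h2
    rw [← h2]
    refine integral_congr_ae (.of_forall fun p => ?_)
    simp only
    ring
  rw [setIntegral_eq_zero_of_forall_eq_zero hl] at hswap
  have hr : ∀ p ∈ Ioi (0 : ℝ), ∫ t in Ioi (0 : ℝ),
      Complex.exp (((-2 * Real.pi * t * p : ℝ) : ℂ) * Complex.I) *
        (Complex.exp (-(c * z) * t) * K p) = c⁻¹ * (K p * (((p : ℂ) + z) ^ (0 + 1))⁻¹) := by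
    intro p hp
    have h3 := integral_exp_mul_complex_Ioi (hre p) 0
    calc _ = ∫ t in Ioi (0 : ℝ), Complex.exp (-(c * (p + z)) * t) * K p := by
          refine integral_congr_ae (.of_forall fun t => ?_)
          simp only
          rw [← mul_assoc, ← Complex.exp_add]
          congr 2
          rw [hc]
          push_cast
          ring
      _ = _ := by
          rw [integral_mul_const, h3]
          have := add_ne_zero_of_im_lt_re hp (hz.trans hzre)
          simp only [Complex.ofReal_zero, mul_zero, Complex.exp_zero]
          field_simp
          ring
  rw [setIntegral_congr_fun measurableSet_Ioi hr, integral_const_mul] at hswap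
  exact (mul_eq_zero.1 hswap.symm).resolve_left (inv_ne_zero hc0)

lemma integral_polynomial_eq_zero {K : ℝ → ℂ} (hK : IntegrableOn K (Ioi 0))
    (h : ∀ n, stieltjes K n 1 = 0) (P : Polynomial ℝ) :
    IntegrableOn (fun p : ℝ => K p * (((p + 1)⁻¹ * P.eval (p + 1)⁻¹ : ℝ) : ℂ)) (Ioi 0) ∧
      ∫ p in Ioi (0 : ℝ), K p * (((p + 1)⁻¹ * P.eval (p + 1)⁻¹ : ℝ) : ℂ) = 0 := by
  have heq : (fun p : ℝ => K p * (((p + 1)⁻¹ * P.eval (p + 1)⁻¹ : ℝ) : ℂ)) = fun p : ℝ =>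
      ∑ i ∈ Finset.range (P.natDegree + 1),
        (P.coeff i : ℂ) * (K p * (((p : ℂ) + 1) ^ (i + 1))⁻¹) := by
    funext p
    rw [Polynomial.eval_eq_sum_range, Finset.mul_sum, Complex.ofReal_sum, Finset.mul_sum]
    refine Finset.sum_congr rfl fun i _ => ?_
    push_cast
    rw [pow_succ, mul_inv, inv_pow]
    ring
  have hint := fun i : ℕ => (integrableOn_stieltjes hK (i + 1) (z := 1) (by simp)).const_mul
    (P.coeff i : ℂ)
  rw [heq]
  refine ⟨integrable_finsetSum _ fun i _ => hint i, ?_⟩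
  rw [integral_finsetSum _ fun i _ => hint i]
  refine Finset.sum_eq_zero fun i _ => ?_
  rw [integral_const_mul]
  exact mul_eq_zero_of_right _ (h i)

lemma continuousOn_inv_mul_comp {φ : ℝ → ℝ} (hφ : Continuous φ) (hc : HasCompactSupport φ) :
    ContinuousOn (fun y : ℝ => y⁻¹ * φ (y⁻¹ - 1)) (Icc 0 1) := by
  intro y hy
  rcases hy.1.eq_or_lt with rfl | hy0
  · obtain ⟨M, hM⟩ := hc.isCompact.bddAbove
    have hz : (fun y : ℝ => y⁻¹ * φ (y⁻¹ - 1)) =ᶠ[nhdsWithin 0 (Icc 0 1)] fun _ => 0 := by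
      have : Iio (|M| + 2)⁻¹ ∈ nhdsWithin (0 : ℝ) (Icc 0 1) :=
        mem_nhdsWithin_of_mem_nhds (Iio_mem_nhds (by positivity))
      filter_upwards [this, self_mem_nhdsWithin] with y hy1 hy2
      rcases hy2.1.eq_or_lt with rfl | hy0
      · simp
      · have h1 : |M| + 2 < y⁻¹ := (lt_inv_comm₀ hy0 (by positivity)).1 hy1
        have h2 : φ (y⁻¹ - 1) = 0 := image_eq_zero_of_notMem_tsupport fun hm => by
          linarith [hM hm, le_abs_self M]
        rw [h2, mul_zero]
    exact continuousWithinAt_const.congr_of_eventuallyEq hz (by simp)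
  · have h1 : ContinuousAt (fun y : ℝ => y⁻¹) y := continuousAt_inv₀ hy0.ne'
    exact (h1.mul (hφ.continuousAt.comp (h1.sub continuousAt_const))).continuousWithinAt

/-- An integrable function on `(0,∞)` is determined by its Stieltjes transforms at `1`. -/
lemma ae_eq_zero_of_stieltjes_eq_zero {K : ℝ → ℂ} (hK : IntegrableOn K (Ioi 0))
    (h : ∀ n, stieltjes K n 1 = 0) : ∀ᵐ p : ℝ, p ∈ Ioi (0 : ℝ) → K p = 0 := by
  refine isOpen_Ioi.ae_eq_zero_of_integral_contDiff_smul_eq_zero hK.locallyIntegrableOn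
    fun φ hφ hc hs => ?_
  rw [← setIntegral_eq_integral_of_forall_compl_eq_zero (s := Ioi (0 : ℝ)) fun x hx => by
    rw [image_eq_zero_of_notMem_tsupport fun hm => hx (hs hm), zero_smul]]
  refine eq_zero_of_forall_norm_le_mul (C := ∫ p in Ioi (0 : ℝ), ‖K p‖) fun ε hε _ => ?_
  obtain ⟨P, hP⟩ := exists_polynomial_near_of_continuousOn 0 1 _
    (continuousOn_inv_mul_comp hφ.continuous hc) ε hε
  obtain ⟨hPi, hP0⟩ := integral_polynomial_eq_zero hK h P
  obtain ⟨B, hB⟩ := hc.exists_bound_of_continuous hφ.continuous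
  have hφi : IntegrableOn (fun p => φ p • K p) (Ioi 0) :=
    hK.bdd_smul B hφ.continuous.aestronglyMeasurable (.of_forall hB)
  rw [← sub_zero (∫ p in Ioi (0 : ℝ), φ p • K p), ← hP0, ← integral_sub hφi hPi,
    ← integral_mul_const]
  refine norm_integral_le_of_norm_le (hK.norm.mul_const ε) ?_
  filter_upwards [ae_restrict_mem measurableSet_Ioi] with p hp
  have hp : 0 < p := hp
  have h1 : 0 < p + 1 := by linarith
  have h2 := (hP (p + 1)⁻¹ ⟨by positivity, inv_le_one_of_one_le₀ (by linarith)⟩).le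
  rw [inv_inv, add_sub_cancel_right] at h2
  have h3 : φ p • K p - K p * (((p + 1)⁻¹ * P.eval (p + 1)⁻¹ : ℝ) : ℂ) =
      K p * (((p + 1)⁻¹ * ((p + 1) * φ p - P.eval (p + 1)⁻¹) : ℝ) : ℂ) := by
    rw [mul_sub, inv_mul_cancel_left₀ h1.ne', Complex.real_smul]
    push_cast
    ring
  rw [h3, norm_mul, Complex.norm_real, norm_mul, Real.norm_of_nonneg (by positivity),
    Real.norm_eq_abs, abs_sub_comm]
  gcongr
  calc _ ≤ 1 * ε := mul_le_mul (inv_le_one_of_one_le₀ (by linarith)) h2 (abs_nonneg _) zero_le_one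
    _ = ε := one_mul ε

lemma fourier_dilate {c : ℝ} (hc : 0 < c) (F : 𝓢(ℝ, ℂ)) (p : ℝ) :
    𝓕 (dilate c hc.ne' F) p = (c⁻¹ : ℝ) • 𝓕 F (c⁻¹ * p) := by
  rw [fourierS_apply, fourierS_apply]
  have h := Measure.integral_comp_mul_left (fun y : ℝ =>
    Complex.exp (((-2 * Real.pi * y * (c⁻¹ * p) : ℝ) : ℂ) * Complex.I) * F y) c
  rw [abs_of_pos (inv_pos.2 hc)] at h
  rw [← h]
  refine integral_congr_ae (.of_forall fun x => ?_)
  simp only [dilate_apply]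
  congr 4
  field_simp

lemma tsupport_subset_Ioi_iff {F : 𝓢(ℝ, ℂ)} :
    tsupport F ⊆ Ioi 0 ↔ tsupport (reflect F) ⊆ Iio 0 := by
  have hr : (reflect F : ℝ → ℂ) = F ∘ Homeomorph.neg ℝ := funext fun x => reflect_apply F x
  rw [hr, tsupport_comp_eq_preimage]
  refine ⟨fun h x hx => ?_, fun h x hx => ?_⟩
  · have h1 : 0 < -x := h hx
    exact neg_pos.1 h1
  · have h1 : -x < 0 := @h (-x) (by simpa using hx)
    exact neg_neg_iff_pos.1 h1

lemma tsupport_subset_Ioi_iff_exists {F : 𝓢(ℝ, ℂ)} :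
    tsupport F ⊆ Ioi 0 ↔ ∃ a > 0, ∀ x ≤ a, F x = 0 := by
  rw [tsupport_subset_Ioi_iff, tsupport_subset_Iio_iff]
  constructor
  · rintro ⟨a, ha, h⟩
    refine ⟨-a, neg_pos.2 ha, fun x hx => ?_⟩
    have := h (-x) (by linarith)
    rwa [reflect_apply, neg_neg] at this
  · rintro ⟨a, ha, h⟩
    exact ⟨-a, neg_neg_iff_pos.2 ha, fun x hx => by
      rw [reflect_apply]; exact h _ (by linarith)⟩

/-- The Fourier transforms of real test functions supported in `(0,∞)` are total. -/
lemma eq_zero_of_inner_fourier_eq_zero (g : Lp ℂ 2 muW)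
    (h : ∀ F : 𝓢(ℝ, ℂ), conjS F = F → tsupport F ⊆ Ioi 0 → inner ℂ g (toH (𝓕 F)) = 0) :
    g = 0 := by
  have hmul : ∀ F : 𝓢(ℝ, ℂ), conjS F = F → tsupport F ⊆ Ioi 0 →
      ∀ᵐ p : ℝ, p ∈ Ioi (0 : ℝ) → (p : ℂ) * (conj (g p) * 𝓕 F p) = 0 := by
    intro F hr hs
    have hK := integrable_inner_toH g (𝓕 F)
    refine ae_eq_zero_of_stieltjes_eq_zero hK fun n => stieltjes_eq_zero hK
      (fun z hz hzre => stieltjes_zero_eq_zero hK (fun t ht => ?_) hz hzre) n (by simp)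
    have hr' : conjS (translateS (-t) F) = translateS (-t) F := by
      ext x
      rw [conjS_apply, translateS_apply, ← conjS_apply, hr]
    have hs' : tsupport (translateS (-t) F) ⊆ Ioi 0 := by
      obtain ⟨a, ha, h0⟩ := tsupport_subset_Ioi_iff_exists.1 hs
      exact tsupport_subset_Ioi_iff_exists.2 ⟨a, ha, fun x hx => by
        rw [translateS_apply]; exact h0 _ (by linarith)⟩
    rw [← h _ hr' hs', inner_toH]
    refine integral_congr_ae (.of_forall fun p => ?_)
    simp only [fourier_translateS]
    have : (-2 * Real.pi * t * p : ℝ) = 2 * Real.pi * -t * p := by ring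
    rw [this]
    ring
  obtain ⟨ψ, hψ, hψs, hψr⟩ := exists_real_unit_mass
  have hFs : tsupport (reflect ψ) ⊆ Ioi 0 := by
    rwa [tsupport_subset_Ioi_iff, reflect_reflect]
  have hc : ∀ n : ℕ, (0 : ℝ) < n + 1 := fun n => by positivity
  have hall : ∀ᵐ p : ℝ, ∀ n : ℕ, p ∈ Ioi (0 : ℝ) →
      (p : ℂ) * (conj (g p) * 𝓕 (dilate (n + 1) (hc n).ne' (reflect ψ)) p) = 0 := by
    refine ae_all_iff.2 fun n => hmul _ ?_ ?_
    · ext x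
      rw [conjS_apply, dilate_apply, reflect_apply, hψr]
    · obtain ⟨a, ha, h0⟩ := tsupport_subset_Ioi_iff_exists.1 hFs
      refine tsupport_subset_Ioi_iff_exists.2 ⟨a / (n + 1), div_pos ha (hc n), fun x hx => ?_⟩
      rw [dilate_apply]
      exact h0 _ (by rwa [le_div_iff₀' (hc n)] at hx)
  have hF0 : 𝓕 (reflect ψ) 0 ≠ 0 := by
    have : 𝓕 (reflect ψ) 0 = 1 := by
      rw [fourier_reflect, fourierInv_apply, fourierS_apply]
      simpa using hψ
    rw [this]
    exact one_ne_zero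
  have hlim : ∀ p : ℝ, ∃ n : ℕ, 𝓕 (reflect ψ) (((n : ℝ) + 1)⁻¹ * p) ≠ 0 := fun p => by
    have h1 : Filter.Tendsto (fun n : ℕ => ((n : ℝ) + 1)⁻¹ * p) Filter.atTop (nhds 0) := by
      have := (tendsto_one_div_add_atTop_nhds_zero_nat (𝕜 := ℝ)).mul_const p
      simpa using this
    have h2 := ((𝓕 (reflect ψ)).continuous.tendsto 0).comp h1
    exact (h2.eventually_ne hF0).exists
  rw [Lp.eq_zero_iff_ae_eq_zero]
  refine muW_absolutelyContinuous.ae_le ?_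
  refine (ae_restrict_iff' measurableSet_Ioi).2 ?_
  filter_upwards [hall] with p hp hp0
  obtain ⟨n, hn⟩ := hlim p
  have h1 := hp n hp0
  rw [fourier_dilate (hc n)] at h1
  have hp1 : (p : ℂ) ≠ 0 := Complex.ofReal_ne_zero.2 (ne_of_gt hp0)
  have h2 := (mul_eq_zero.1 ((mul_eq_zero.1 h1).resolve_left hp1)).resolve_right
    (smul_ne_zero (inv_ne_zero (hc n).ne') hn)
  simpa using h2

lemma mem_Hzero_iff_inner {g : Lp ℂ 2 muW} :
    g ∈ Hzero ↔ ∀ F : 𝓢(ℝ, ℂ), tsupport F ⊆ Iio 0 →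
      inner ℂ (toH (𝓕 (conjS F))) g = inner ℂ g (toH (𝓕 F)) := by
  rw [mem_Hzero_iff]
  refine forall₂_congr fun F _ => ?_
  rw [defect_apply, sub_eq_zero, ← conjS_conjS (𝓕⁻ F), ← fourier_conjS, inner_star_toH_conjS,
    inner_conj_symm]

lemma toH_fourier_mem_Hzero {F : 𝓢(ℝ, ℂ)} (hr : conjS F = F) (hs : tsupport F ⊆ Ioi 0) :
    toH (𝓕 F) ∈ Hzero := by
  have hF : ∀ x, conj (F x) = F x := fun x => by rw [← conjS_apply, hr]
  have hu : ∀ h : 𝓢(ℝ, ℂ), (SchwartzMap.integralCLM ℂ volume).comp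
      (SchwartzMap.smulLeftCLM ℂ F) h = ∫ x, F x * h x := fun h => by
    rw [ContinuousLinearMap.comp_apply, SchwartzMap.integralCLM_apply]
    simp_rw [SchwartzMap.smulLeftCLM_apply_apply F.hasTemperateGrowth, smul_eq_mul]
  refine ⟨(SchwartzMap.integralCLM ℂ volume).comp (SchwartzMap.smulLeftCLM ℂ F),
    fun h h' hh => ?_, fun h hh => ?_, fun h _ hh => ?_⟩
  · rw [hu, hu, ← integral_conj]
    simp_rw [map_mul, hF, hh]
  · rw [hu]
    refine integral_eq_zero_of_ae (.of_forall fun x => ?_)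
    change F x * h x = 0
    by_cases hx : x ∈ tsupport F
    · have h0 : 0 < x := hs hx
      have hm : x ∉ tsupport h := fun h' => lt_asymm h0 (show x < 0 from hh h')
      rw [image_eq_zero_of_notMem_tsupport hm, mul_zero]
    · rw [image_eq_zero_of_notMem_tsupport hx, zero_mul]
  · rw [SchwartzMap.fourierTransformCLM_apply, hu, ← SchwartzMap.integral_fourier_mul_eq,
      ← setIntegral_eq_integral_of_forall_compl_eq_zero (s := Ioi (0 : ℝ)) fun x hx => by
        rw [image_eq_zero_of_notMem_tsupport fun hm => hx (hh hm), mul_zero]]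
    refine integral_congr_ae ?_
    filter_upwards [absolutelyContinuous_muW.ae_le (coeFn_toH (𝓕 F))] with p hp
    rw [hp]

lemma zero_mem_Hzero : (0 : Lp ℂ 2 muW) ∈ Hzero :=
  mem_Hzero_iff_inner.2 fun F _ => by rw [inner_zero_left, inner_zero_right]

lemma add_mem_Hzero {a b : Lp ℂ 2 muW} (ha : a ∈ Hzero) (hb : b ∈ Hzero) : a + b ∈ Hzero :=
  mem_Hzero_iff_inner.2 fun F hF => by
    rw [inner_add_left, inner_add_right, mem_Hzero_iff_inner.1 ha F hF,
      mem_Hzero_iff_inner.1 hb F hF]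

lemma smul_mem_Hzero (r : ℝ) {a : Lp ℂ 2 muW} (ha : a ∈ Hzero) : (r : ℂ) • a ∈ Hzero :=
  mem_Hzero_iff_inner.2 fun F hF => by
    rw [inner_smul_left, inner_smul_right, mem_Hzero_iff_inner.1 ha F hF, Complex.conj_ofReal]

lemma isClosed_Hzero : IsClosed Hzero := by
  have : Hzero = ⋂ (F : 𝓢(ℝ, ℂ)) (_ : tsupport F ⊆ Iio 0), {g : Lp ℂ 2 muW |
      inner ℂ (toH (𝓕 (conjS F))) g = inner ℂ g (toH (𝓕 F))} := by
    ext g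
    simp only [mem_iInter, mem_Hzero_iff_inner]
    rfl
  rw [this]
  exact isClosed_iInter fun F => isClosed_iInter fun _ =>
    isClosed_eq (continuous_const.inner continuous_id) (continuous_id.inner continuous_const)

lemma eq_zero_of_mem_of_I_smul_mem {g : Lp ℂ 2 muW} (hg : g ∈ Hzero)
    (hIg : Complex.I • g ∈ Hzero) : g = 0 := by
  have h0 : ∀ F : 𝓢(ℝ, ℂ), tsupport F ⊆ Iio 0 → inner ℂ g (toH (𝓕 F)) = 0 := fun F hF => by
    have h1 := mem_Hzero_iff_inner.1 hg F hF
    have h2 := mem_Hzero_iff_inner.1 hIg F hF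
    rw [inner_smul_left, inner_smul_right, h1, Complex.conj_I] at h2
    have h3 : (2 * Complex.I) * inner ℂ g (toH (𝓕 F)) = 0 := by linear_combination h2
    exact (mul_eq_zero.1 h3).resolve_left (by simp)
  suffices hs0 : star g = 0 by
    rw [Lp.eq_zero_iff_ae_eq_zero] at hs0 ⊢
    filter_upwards [hs0, Lp.coeFn_star g] with p hp hp'
    rw [hp, Pi.zero_apply, Pi.star_apply, eq_comm, star_eq_zero] at hp'
    exact hp'
  refine eq_zero_of_inner_fourier_eq_zero (star g) fun F hr hs => ?_
  have h1 : 𝓕 F = conjS (𝓕 (reflect F)) := by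
    rw [← fourierInv_conjS, ← reflect_conjS, hr, fourierInv_reflect]
  rw [h1, inner_star_toH_conjS, h0 _ (tsupport_subset_Ioi_iff.1 hs), map_zero]

lemma dense_Hzero_add_I_smul_Hzero :
    Dense {g : Lp ℂ 2 muW | ∃ a ∈ Hzero, ∃ b ∈ Hzero, g = a + Complex.I • b} := by
  let W : Submodule ℂ (Lp ℂ 2 muW) :=
    { carrier := {g | ∃ a ∈ Hzero, ∃ b ∈ Hzero, g = a + Complex.I • b}
      zero_mem' := ⟨0, zero_mem_Hzero, 0, zero_mem_Hzero, by rw [smul_zero, add_zero]⟩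
      add_mem' := by
        rintro _ _ ⟨a, ha, b, hb, rfl⟩ ⟨a', ha', b', hb', rfl⟩
        exact ⟨a + a', add_mem_Hzero ha ha', b + b', add_mem_Hzero hb hb', by module⟩
      smul_mem' := by
        rintro c _ ⟨a, ha, b, hb, rfl⟩
        refine ⟨(c.re : ℂ) • a + ((-c.im : ℝ) : ℂ) • b,
          add_mem_Hzero (smul_mem_Hzero _ ha) (smul_mem_Hzero _ hb),
          (c.re : ℂ) • b + (c.im : ℂ) • a,
          add_mem_Hzero (smul_mem_Hzero _ hb) (smul_mem_Hzero _ ha), ?_⟩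
        have hI : Complex.I * Complex.I = -1 := Complex.I_mul_I
        conv_lhs => rw [← Complex.re_add_im c]
        match_scalars
        · ring
        · linear_combination (c.im : ℂ) * hI }
  change Dense (W : Set (Lp ℂ 2 muW))
  rw [Submodule.dense_iff_topologicalClosure_eq_top, Submodule.topologicalClosure_eq_top_iff,
    Submodule.eq_bot_iff]
  refine fun g hg => eq_zero_of_inner_fourier_eq_zero g fun F hr hs => ?_
  exact (Submodule.mem_orthogonal' W g).1 hg _
    ⟨_, toH_fourier_mem_Hzero hr hs, 0, zero_mem_Hzero, by rw [smul_zero, add_zero]⟩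

/-- `H₀` is a standard subspace of `L²((0,∞), p dp)`: a closed real-linear subspace with
`H₀ ∩ i H₀ = {0}` and `H₀ + i H₀` dense. -/
theorem stmt_7 :
    (0 : Lp ℂ 2 muW) ∈ Hzero ∧
    (∀ a ∈ Hzero, ∀ b ∈ Hzero, a + b ∈ Hzero) ∧
    (∀ (r : ℝ), ∀ a ∈ Hzero, (r : ℂ) • a ∈ Hzero) ∧
    IsClosed Hzero ∧
    (Hzero ∩ {g | ∃ h ∈ Hzero, g = Complex.I • h} = {0}) ∧
    Dense {g : Lp ℂ 2 muW | ∃ a ∈ Hzero, ∃ b ∈ Hzero, g = a + Complex.I • b} := by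
  refine ⟨zero_mem_Hzero, fun a ha b hb => add_mem_Hzero ha hb,
    fun r a ha => smul_mem_Hzero r ha, isClosed_Hzero, ?_, dense_Hzero_add_I_smul_Hzero⟩
  refine eq_singleton_iff_unique_mem.2
    ⟨⟨zero_mem_Hzero, 0, zero_mem_Hzero, (smul_zero _).symm⟩, ?_⟩
  rintro _ ⟨hIh, h, hh, rfl⟩
  rw [eq_zero_of_mem_of_I_smul_mem hh hIh, smul_zero]
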